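/- For every integer n ≥ 3 there exist a Ważewski dendrite X of order n and a finitely generated subgroup G of Homeo(X), dense in Homeo(X), such that G contains a subgroup isomorphic to the free group of rank 2. -/

import Mathlib

open Topology

/-- The set of connected components of a subset `S` of `X`. -/
def setComponents (X : Type*) [TopologicalSpace X] (S : Set X) : Set (Set X) :=
  {C | ∃ x ∈ S, C = connectedComponentIn S x}

/-- The order of a point `p` of `X`: the number of connected components of `X \ {p}`. -/
noncomputable def ptOrder (X : Type*) [TopologicalSpace X] (p : X) : ℕ :=
  (setComponents X {p}ᶜ).ncard

/-- A dendrite: a nonempty, compact, connected, locally connected metrizable space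
containing no subspace homeomorphic to the circle. -/
def IsDendrite (X : Type*) [TopologicalSpace X] : Prop :=
  Nonempty X ∧ CompactSpace X ∧ ConnectedSpace X ∧ LocallyConnectedSpace X ∧
    TopologicalSpace.MetrizableSpace X ∧
    ∀ S : Set X, IsEmpty (S ≃ₜ Circle)

/-- A Ważewski dendrite of order `n`: a dendrite all of whose points have order `1`, `2`
or `n`, and every arc (subspace homeomorphic to `[0,1]`) contains a point of order `n`. -/
def IsWazewskiDendrite (n : ℕ) (X : Type*) [TopologicalSpace X] : Prop :=
  IsDendrite X ∧
  (∀ p : X, ptOrder X p = 1 ∨ ptOrder X p = 2 ∨ ptOrder X p = n) ∧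
  ∀ A : Set X, Nonempty (A ≃ₜ unitInterval) → ∃ p ∈ A, ptOrder X p = n

/-- The group structure on self-homeomorphisms of `X`, with composition as product. -/
instance Homeomorph.instGroupSelf (X : Type*) [TopologicalSpace X] : Group (X ≃ₜ X) where
  mul f g := g.trans f
  one := Homeomorph.refl X
  inv := Homeomorph.symm
  mul_assoc _ _ _ := rfl
  one_mul _ := Homeomorph.ext fun _ => rfl
  mul_one _ := Homeomorph.ext fun _ => rfl
  inv_mul_cancel := Homeomorph.self_trans_symm

/-- The compact-open topology on the group of self-homeomorphisms of `X` (for compact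
metric `X`, this is the topology of uniform convergence). -/
instance Homeomorph.instTopSelf (X : Type*) [TopologicalSpace X] :
    TopologicalSpace (X ≃ₜ X) :=
  TopologicalSpace.induced (fun h : X ≃ₜ X => (h : C(X, X))) ContinuousMap.compactOpen


namespace Wz

/-- The Cantor space of infinite words in `N + 3` letters. -/
abbrev Wd (N : ℕ) : Type := ℕ → Fin (N + 3)

/-- Two words are identified when they differ only in the letter before a tail `0111...`. -/
def Rel {N : ℕ} (z z' : Wd N) : Prop :=
  z = z' ∨ ∃ k, (∀ j, j ≠ k → z j = z' j) ∧ z (k + 1) = 0 ∧ ∀ j, k + 1 < j → z j = 1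

def wSetoid (N : ℕ) : Setoid (Wd N) where
  r := Rel
  iseqv := by
    refine ⟨fun z => Or.inl rfl, ?_, ?_⟩
    · rintro z z' (h | ⟨k, h1, h2, h3⟩)
      · exact Or.inl h.symm
      · refine Or.inr ⟨k, fun j hj => (h1 j hj).symm, ?_, fun j hj => ?_⟩
        · rw [← h1 _ (by omega)]; exact h2
        · rw [← h1 _ (by omega)]; exact h3 j hj
    · rintro x y z (h | ⟨k, h1, h2, h3⟩) (h' | ⟨k', h1', h2', h3'⟩)
      · exact Or.inl (h.trans h')
      · subst h; exact Or.inr ⟨k', h1', h2', h3'⟩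
      · subst h'; exact Or.inr ⟨k, h1, h2, h3⟩
      · have hk : k = k' := by
          rcases lt_trichotomy k k' with hlt | heq | hlt
          · have e1 := h3 (k' + 1) (by omega)
            rw [h1 _ (by omega), h2'] at e1
            simp at e1
          · exact heq
          · have e1 := h3' (k + 1) (by omega)
            rw [← h1 _ (by omega), h2] at e1
            simp at e1
        subst hk
        exact Or.inr ⟨k, fun j hj => (h1 j hj).trans (h1' j hj), h2, h3⟩

/-- The dendrite. -/
def D (N : ℕ) : Type := Quotient (wSetoid N)

instance instTopD (N : ℕ) : TopologicalSpace (D N) :=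
  inferInstanceAs (TopologicalSpace (Quotient (wSetoid N)))

variable {N : ℕ}

/-- The projection from words. -/
def pr (z : Wd N) : D N := Quotient.mk (wSetoid N) z

theorem pr_quot : IsQuotientMap (pr : Wd N → D N) := isQuotientMap_quot_mk

theorem pr_cont : Continuous (pr : Wd N → D N) := pr_quot.continuous

theorem pr_surj (x : D N) : ∃ z, pr z = x := Quotient.exists_rep x

theorem pr_eq {z z' : Wd N} : pr z = pr z' ↔ Rel z z' := Quotient.eq (r := wSetoid N)

instance : CompactSpace (D N) := by
  constructor
  rw [← Set.range_eq_univ.2 (pr_quot (N := N)).surjective]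
  exact isCompact_range pr_cont

def wcons (i : Fin (N + 3)) (z : Wd N) : Wd N
  | 0 => i
  | k + 1 => z k

def wtail (z : Wd N) : Wd N := fun k => z (k + 1)

@[simp] theorem wcons_zero (i : Fin (N + 3)) (z : Wd N) : wcons i z 0 = i := rfl
@[simp] theorem wcons_succ (i : Fin (N + 3)) (z : Wd N) (k : ℕ) : wcons i z (k + 1) = z k := rfl
@[simp] theorem wtail_wcons (i : Fin (N + 3)) (z : Wd N) : wtail (wcons i z) = z := rfl
theorem wcons_wtail (z : Wd N) : wcons (z 0) (wtail z) = z := by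
  funext k; cases k <;> rfl

theorem wcons_cont (i : Fin (N + 3)) : Continuous (wcons i : Wd N → Wd N) := by
  refine continuous_pi fun k => ?_
  cases k with
  | zero => exact continuous_const
  | succ k => exact continuous_apply k

theorem wtail_cont : Continuous (wtail : Wd N → Wd N) :=
  continuous_pi fun k => continuous_apply (k + 1)

def wb : Wd N := fun _ => 1
def wa : Wd N := wcons 0 wb

/-- The two end points of the dendrite. -/
def b : D N := pr wb
def a : D N := pr wa

theorem rel_wcons {i j : Fin (N + 3)} {z z' : Wd N} :
    Rel (wcons i z) (wcons j z') ↔ (i = j ∧ Rel z z') ∨ (z = wa ∧ z' = wa) := by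
  constructor
  · rintro (h | ⟨k, h1, h2, h3⟩)
    · exact Or.inl ⟨congrFun h 0, Or.inl (congrArg wtail h)⟩
    · cases k with
      | zero =>
        right
        have e : z = wa := by
          funext k
          cases k with
          | zero => exact h2
          | succ k => exact h3 (k + 2) (by omega)
        refine ⟨e, ?_⟩
        rw [← e]
        funext k
        exact (h1 (k + 1) (by omega)).symm
      | succ k =>
        left
        refine ⟨h1 0 (by omega), Or.inr ⟨k, fun j hj => h1 (j + 1) (by omega), h2,
          fun j hj => h3 (j + 1) (by omega)⟩⟩
  · rintro (⟨rfl, h | ⟨k, h1, h2, h3⟩⟩ | ⟨rfl, rfl⟩)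
    · exact Or.inl (by rw [h])
    · refine Or.inr ⟨k + 1, fun j hj => ?_, h2, fun j hj => ?_⟩
      · cases j with
        | zero => rfl
        | succ j => exact h1 j (by omega)
      · cases j with
        | zero => omega
        | succ j => exact h3 j (by omega)
    · refine Or.inr ⟨0, fun j hj => ?_, rfl, fun j hj => ?_⟩
      · cases j with
        | zero => omega
        | succ j => rfl
      · obtain ⟨j, rfl⟩ : ∃ l, j = l + 2 := ⟨j - 2, by omega⟩
        rfl

theorem rel_wa {z : Wd N} (h : Rel wa z) : z = wa := by
  rcases h with h | ⟨k, h1, h2, h3⟩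
  · exact h.symm
  · exact absurd (show (1 : Fin (N + 3)) = 0 from h2) (by simp)

theorem rel_wb {z : Wd N} (h : Rel wb z) : z = wb := by
  rcases h with h | ⟨k, h1, h2, h3⟩
  · exact h.symm
  · exact absurd (show (1 : Fin (N + 3)) = 0 from h2) (by simp)

theorem pr_eq_a {z : Wd N} : pr z = a ↔ z = wa :=
  ⟨fun h => rel_wa (pr_eq.1 h.symm), fun h => by rw [h]; rfl⟩

theorem pr_eq_b {z : Wd N} : pr z = b ↔ z = wb :=
  ⟨fun h => rel_wb (pr_eq.1 h.symm), fun h => by rw [h]; rfl⟩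

theorem a_ne_b : (a : D N) ≠ b := fun h => by
  have h1 : (wa : Wd N) = wb := pr_eq_b.1 h
  have h2 : (0 : Fin (N + 3)) = 1 := congrFun h1 0
  simp at h2

/-- The contractions. -/
def phi (i : Fin (N + 3)) : D N → D N :=
  Quotient.lift (fun z => pr (wcons i z)) fun _ _ h => pr_eq.2 (rel_wcons.2 (Or.inl ⟨rfl, h⟩))

theorem phi_pr (i : Fin (N + 3)) (z : Wd N) : phi i (pr z) = pr (wcons i z) := rfl

theorem phi_cont (i : Fin (N + 3)) : Continuous (phi i : D N → D N) :=
  pr_quot.continuous_iff.2 (pr_cont.comp (wcons_cont i))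

theorem phi_eq {i j : Fin (N + 3)} {x y : D N} :
    phi i x = phi j y ↔ (i = j ∧ x = y) ∨ (x = a ∧ y = a) := by
  obtain ⟨z, rfl⟩ := pr_surj x
  obtain ⟨z', rfl⟩ := pr_surj y
  rw [phi_pr, phi_pr, pr_eq, rel_wcons, pr_eq, pr_eq_a, pr_eq_a]

theorem phi_inj (i : Fin (N + 3)) : Function.Injective (phi i : D N → D N) := by
  intro x y h
  rcases phi_eq.1 h with h | h
  · exact h.2
  · rw [h.1, h.2]

theorem phi_surj (x : D N) : ∃ i y, phi i y = x := by
  obtain ⟨z, rfl⟩ := pr_surj x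
  exact ⟨z 0, pr (wtail z), by rw [phi_pr, wcons_wtail]⟩

theorem phi_zero_b : phi 0 b = (a : D N) := rfl

theorem phi_one_b : phi 1 b = (b : D N) := by
  rw [b, phi_pr]
  congr 1
  funext k
  cases k <;> rfl

/-- The central branch point. -/
def m : D N := phi 0 a

theorem phi_a (i : Fin (N + 3)) : phi i a = (m : D N) := phi_eq.2 (Or.inr ⟨rfl, rfl⟩)

theorem phi_eq_m {i : Fin (N + 3)} {x : D N} : phi i x = m ↔ x = a := by
  rw [← phi_a i]
  exact (phi_inj i).eq_iff

theorem phi_eq_a {i : Fin (N + 3)} {x : D N} : phi i x = a ↔ i = 0 ∧ x = b := by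
  rw [← phi_zero_b, phi_eq]
  constructor
  · rintro (h | h)
    · exact h
    · exact absurd h.2.symm a_ne_b
  · exact Or.inl

theorem phi_eq_b {i : Fin (N + 3)} {x : D N} : phi i x = b ↔ i = 1 ∧ x = b := by
  conv_lhs => rw [← phi_one_b, phi_eq]
  constructor
  · rintro (h | h)
    · exact h
    · exact absurd h.2.symm a_ne_b
  · exact Or.inl

theorem m_ne_a : (m : D N) ≠ a := fun h => a_ne_b (phi_eq_a.1 h).2
theorem m_ne_b : (m : D N) ≠ b := fun h => a_ne_b (phi_eq_b.1 h).2

/-- Gluing maps. -/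
def glue {Z : Type*} (f : Fin (N + 3) → D N → Z) (hf : ∀ i j, f i a = f j a) : D N → Z :=
  Quotient.lift (fun z => f (z 0) (pr (wtail z))) fun z z' h => by
    rw [← wcons_wtail z, ← wcons_wtail z'] at h
    rcases rel_wcons.1 h with ⟨h1, h2⟩ | ⟨h1, h2⟩
    · rw [h1, pr_eq.2 h2]
    · rw [h1, h2]; exact hf _ _

theorem glue_phi {Z : Type*} (f : Fin (N + 3) → D N → Z) (hf : ∀ i j, f i a = f j a)
    (i : Fin (N + 3)) (x : D N) : glue f hf (phi i x) = f i x := by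
  obtain ⟨z, rfl⟩ := pr_surj x
  rfl

theorem glue_cont {Z : Type*} [TopologicalSpace Z] (f : Fin (N + 3) → D N → Z)
    (hf : ∀ i j, f i a = f j a) (hc : ∀ i, Continuous (f i)) : Continuous (glue f hf) := by
  refine pr_quot.continuous_iff.2 ?_
  have h : Continuous (fun p : Fin (N + 3) × D N => f p.1 p.2) :=
    continuous_prod_of_discrete_left.2 hc
  exact h.comp ((continuous_apply 0).prodMk (pr_cont.comp wtail_cont))

/-- The retractions onto cells. -/
def col (i : Fin (N + 3)) : D N → D N :=
  glue (fun j x => if j = i then x else a) (by intro j k; simp)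

theorem col_phi_self (i : Fin (N + 3)) (x : D N) : col i (phi i x) = x := by
  simp [col, glue_phi]

theorem col_phi_ne {i j : Fin (N + 3)} (h : j ≠ i) (x : D N) : col i (phi j x) = a := by
  simp [col, glue_phi, h]

theorem col_cont (i : Fin (N + 3)) : Continuous (col i : D N → D N) := by
  refine glue_cont _ _ fun j => ?_
  by_cases h : j = i
  · simp only [h, if_true]; exact continuous_id
  · simpa [h] using continuous_const

theorem phi_col {i : Fin (N + 3)} {x : D N} (h : col i x ≠ a) : phi i (col i x) = x := by
  obtain ⟨j, y, rfl⟩ := phi_surj x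
  by_cases hj : j = i
  · subst hj; rw [col_phi_self]
  · exact absurd (col_phi_ne hj y) h

/-- The components of the complement of `m`. -/
def U (i : Fin (N + 3)) : Set (D N) := phi i '' {a}ᶜ

theorem phi_mem_U {i j : Fin (N + 3)} {x : D N} : phi i x ∈ U j ↔ i = j ∧ x ≠ a := by
  constructor
  · rintro ⟨y, hy, h⟩
    rcases phi_eq.1 h with ⟨rfl, rfl⟩ | h
    · exact ⟨rfl, hy⟩
    · exact absurd h.1 hy
  · rintro ⟨rfl, h⟩
    exact ⟨x, h, rfl⟩

theorem m_not_mem_U (i : Fin (N + 3)) : (m : D N) ∉ U i := by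
  rw [m, phi_mem_U]; simp

theorem mem_U_of_ne {x : D N} (h : x ≠ m) : ∃ i, x ∈ U i := by
  obtain ⟨i, y, rfl⟩ := phi_surj x
  exact ⟨i, phi_mem_U.2 ⟨rfl, fun hy => h (by rw [hy, phi_a])⟩⟩

theorem U_unique {i j : Fin (N + 3)} {x : D N} (h : x ∈ U i) (h' : x ∈ U j) : i = j := by
  obtain ⟨y, hy, rfl⟩ := h
  exact (phi_mem_U.1 h').1

theorem U_open (i : Fin (N + 3)) : IsOpen (U i : Set (D N)) := by
  rw [← pr_quot.isOpen_preimage]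
  have : (pr ⁻¹' U i : Set (Wd N)) = {z | z 0 = i} ∩ (wtail ⁻¹' {wa}ᶜ) := by
    ext z
    have : pr z = phi (z 0) (pr (wtail z)) := by rw [phi_pr, wcons_wtail]
    simp only [Set.mem_preimage, this, phi_mem_U, Set.mem_inter_iff, Set.mem_ofPred_eq,
      Set.mem_compl_iff, Set.mem_singleton_iff, ne_eq, pr_eq_a]
  rw [this]
  refine IsOpen.inter ?_ ?_
  · exact (isOpen_discrete ({i} : Set (Fin (N + 3)))).preimage
      (continuous_apply (A := fun _ : ℕ => Fin (N + 3)) 0)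
  · exact isOpen_compl_singleton.preimage wtail_cont

theorem a_mem_U : (a : D N) ∈ U 0 := by
  rw [← phi_zero_b]; exact phi_mem_U.2 ⟨rfl, a_ne_b.symm⟩

theorem b_mem_U : (b : D N) ∈ U 1 := by
  rw [← phi_one_b]; exact phi_mem_U.2 ⟨rfl, a_ne_b.symm⟩

/-! Words -/

def phiw : List (Fin (N + 3)) → D N → D N
  | [], x => x
  | i :: w, x => phi i (phiw w x)

def colw : List (Fin (N + 3)) → D N → D N
  | [], x => x
  | i :: w, x => colw w (col i x)

theorem phiw_cont (w : List (Fin (N + 3))) : Continuous (phiw w : D N → D N) := by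
  induction w with
  | nil => exact continuous_id
  | cons i w ih => exact (phi_cont i).comp ih

theorem colw_cont (w : List (Fin (N + 3))) : Continuous (colw w : D N → D N) := by
  induction w with
  | nil => exact continuous_id
  | cons i w ih => exact ih.comp (col_cont i)

theorem colw_phiw (w : List (Fin (N + 3))) (x : D N) : colw w (phiw w x) = x := by
  induction w with
  | nil => rfl
  | cons i w ih => rw [phiw, colw, col_phi_self, ih]

theorem phiw_append (w v : List (Fin (N + 3))) (x : D N) :
    phiw (w ++ v) x = phiw w (phiw v x) := by
  induction w with
  | nil => rfl
  | cons i w ih => rw [List.cons_append, phiw, phiw, ih]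

/-- Branch points. -/
def mw (w : List (Fin (N + 3))) : D N := phiw w m

theorem mw_cons (i : Fin (N + 3)) (w : List (Fin (N + 3))) : mw (i :: w) = phi i (mw w) := rfl

theorem mw_nil : mw [] = (m : D N) := rfl

theorem mw_ne_b (w : List (Fin (N + 3))) : mw w ≠ b := by
  induction w with
  | nil => exact m_ne_b
  | cons i w ih => exact fun h => ih (phi_eq_b.1 h).2

theorem mw_ne_a (w : List (Fin (N + 3))) : mw w ≠ a := by
  cases w with
  | nil => exact m_ne_a
  | cons i w => exact fun h => mw_ne_b w (phi_eq_a.1 h).2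

theorem colw_eq_m {w : List (Fin (N + 3))} {x : D N} : colw w x = m ↔ x = mw w := by
  constructor
  · intro h
    induction w generalizing x with
    | nil => exact h
    | cons i w ih =>
      have h1 := ih h
      rw [mw_cons, ← h1, phi_col]
      rw [h1]; exact mw_ne_a w
  · rintro rfl
    exact colw_phiw w m

/-- Half-spaces. -/
def HS (w : List (Fin (N + 3))) (i : Fin (N + 3)) : Set (D N) := colw w ⁻¹' U i

theorem HS_open (w : List (Fin (N + 3))) (i : Fin (N + 3)) : IsOpen (HS w i : Set (D N)) :=
  (U_open i).preimage (colw_cont w)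

theorem mw_not_mem_HS (w : List (Fin (N + 3))) (i : Fin (N + 3)) : mw w ∉ HS w i := by
  rw [HS, Set.mem_preimage, colw_eq_m.2 rfl]
  exact m_not_mem_U i

theorem mem_HS_of_ne {w : List (Fin (N + 3))} {x : D N} (h : x ≠ mw w) : ∃ i, x ∈ HS w i :=
  mem_U_of_ne fun e => h (colw_eq_m.1 e)

theorem HS_unique {w : List (Fin (N + 3))} {i j : Fin (N + 3)} {x : D N} (h : x ∈ HS w i)
    (h' : x ∈ HS w j) : i = j := U_unique h h'

theorem sub_HS {w : List (Fin (N + 3))} {i : Fin (N + 3)} {T : Set (D N)} (hT : IsPreconnected T)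
    (hm : mw w ∉ T) {x : D N} (hx : x ∈ T) (hxi : x ∈ HS w i) : T ⊆ HS w i := by
  refine hT.subset_left_of_subset_union (HS_open w i)
    (isOpen_iUnion fun j : {j // j ≠ i} => HS_open w j.1) ?_ ?_ ⟨x, hx, hxi⟩
  · rw [Set.disjoint_left]
    intro y hy hy'
    obtain ⟨⟨j, hj⟩, hy'⟩ := Set.mem_iUnion.1 hy'
    exact hj (HS_unique hy' hy)
  · intro y hy
    obtain ⟨j, hj⟩ := mem_HS_of_ne (w := w) (x := y) (fun e => hm (e ▸ hy))
    by_cases h : j = i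
    · exact Or.inl (h ▸ hj)
    · exact Or.inr (Set.mem_iUnion.2 ⟨⟨j, h⟩, hj⟩)

theorem sub_U {i : Fin (N + 3)} {T : Set (D N)} (hT : IsPreconnected T)
    (hm : m ∉ T) {x : D N} (hx : x ∈ T) (hxi : x ∈ U i) : T ⊆ U i :=
  sub_HS (w := []) hT hm hx hxi

/-! Separation -/

def Sep (x y : D N) : Prop := ∃ w i j, i ≠ j ∧ x ∈ HS w i ∧ y ∈ HS w j

theorem Sep.symm {x y : D N} (h : Sep x y) : Sep y x := by
  obtain ⟨w, i, j, h1, h2, h3⟩ := h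
  exact ⟨w, j, i, h1.symm, h3, h2⟩

theorem Sep.col {x y : D N} {i : Fin (N + 3)} (h : Sep (col i x) (col i y)) : Sep x y := by
  obtain ⟨w, k, j, h1, h2, h3⟩ := h
  exact ⟨i :: w, k, j, h1, h2, h3⟩

theorem Sep.of_U {x y : D N} {i j : Fin (N + 3)} (hij : i ≠ j) (hx : x ∈ U i) (hy : y ∈ U j) :
    Sep x y := ⟨[], i, j, hij, hx, hy⟩

theorem col_b : col 1 b = (b : D N) := by
  conv_lhs => rw [← phi_one_b, col_phi_self]

theorem pr_cons (z : Wd N) : pr z = phi (z 0) (pr (wtail z)) := by rw [phi_pr, wcons_wtail]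

theorem sep_b_aux (k : ℕ) : ∀ z : Wd N, z k ≠ 1 → Sep b (pr z) := by
  have key : ∀ z : Wd N, z 0 ≠ 1 → Sep b (pr z) := by
    intro z hz
    rw [pr_cons z]
    by_cases h : pr (wtail z) = a
    · rw [h, phi_a, ← phi_a 1]
      refine Sep.col (i := 1) ?_
      rw [col_b, col_phi_self]
      exact Sep.of_U (by simp) b_mem_U a_mem_U
    · exact Sep.of_U hz.symm b_mem_U (phi_mem_U.2 ⟨rfl, h⟩)
  induction k with
  | zero => exact key
  | succ k ih =>
    intro z hz
    by_cases h : z 0 = 1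
    · rw [pr_cons z, h]
      refine Sep.col (i := 1) ?_
      rw [col_b, col_phi_self]
      exact ih _ hz
    · exact key z h

theorem ne_b_exists {z : Wd N} (h : pr z ≠ b) : ∃ k, z k ≠ 1 := by
  by_contra! hc
  exact h (pr_eq_b.2 (funext hc))

theorem sep_b {x : D N} (h : x ≠ b) : Sep b x := by
  obtain ⟨z, rfl⟩ := pr_surj x
  obtain ⟨k, hk⟩ := ne_b_exists h
  exact sep_b_aux k z hk

theorem sep_a {x : D N} (h : x ≠ a) : Sep a x := by
  have key : ∀ y : D N, y ≠ b → Sep a (phi 0 y) := by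
    intro y hy
    refine Sep.col (i := 0) ?_
    rw [col_phi_self, ← phi_zero_b, col_phi_self]
    exact sep_b hy
  obtain ⟨k, y, rfl⟩ := phi_surj x
  by_cases hk : k = 0
  · subst hk
    exact key y (fun e => h (by rw [e, phi_zero_b]))
  · by_cases hy : y = a
    · rw [hy, phi_a]
      exact key a a_ne_b
    · exact Sep.of_U (Ne.symm hk) a_mem_U (phi_mem_U.2 ⟨rfl, hy⟩)

theorem sep_aux {i j : Fin (N + 3)} (hij : i ≠ j) {x y : D N} (h : phi i x ≠ phi j y) :
    Sep (phi i x) (phi j y) := by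
  by_cases hx : x = a
  · subst hx
    rw [phi_a, ← phi_a j]
    refine Sep.col (i := j) ?_
    rw [col_phi_self, col_phi_self]
    refine sep_a fun e => h ?_
    rw [e, phi_a, phi_a]
  by_cases hy : y = a
  · subst hy
    rw [phi_a, ← phi_a i]
    refine Sep.symm (Sep.col (i := i) ?_)
    rw [col_phi_self, col_phi_self]
    exact sep_a hx
  exact Sep.of_U hij (phi_mem_U.2 ⟨rfl, hx⟩) (phi_mem_U.2 ⟨rfl, hy⟩)

theorem sep_pr (k : ℕ) : ∀ z z' : Wd N, z k ≠ z' k → pr z ≠ pr z' → Sep (pr z) (pr z') := by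
  induction k with
  | zero =>
    intro z z' h hne
    rw [pr_cons z, pr_cons z'] at *
    exact sep_aux h hne
  | succ k ih =>
    intro z z' h hne
    by_cases h0 : z 0 = z' 0
    · rw [pr_cons z, pr_cons z'] at *
      have h0' := h0
      rw [h0]
      refine Sep.col (i := z' 0) ?_
      rw [col_phi_self, col_phi_self]
      exact ih _ _ h fun e => hne (by rw [e, h0'])
    · rw [pr_cons z, pr_cons z'] at *
      exact sep_aux h0 hne

theorem sep {x y : D N} (h : x ≠ y) : Sep x y := by
  obtain ⟨z, rfl⟩ := pr_surj x
  obtain ⟨z', rfl⟩ := pr_surj y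
  have : ∃ k, z k ≠ z' k := by
    by_contra! hc
    exact h (by rw [funext hc])
  obtain ⟨k, hk⟩ := this
  exact sep_pr k z z' hk h

theorem HS_disjoint {w : List (Fin (N + 3))} {i j : Fin (N + 3)} (h : i ≠ j) :
    Disjoint (HS w i) (HS w j) :=
  Set.disjoint_left.2 fun _ hx hx' => h (HS_unique hx hx')

instance : T2Space (D N) := by
  refine ⟨fun x y hxy => ?_⟩
  obtain ⟨w, i, j, hij, hx, hy⟩ := sep hxy
  exact ⟨_, _, HS_open w i, HS_open w j, hx, hy, HS_disjoint hij⟩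

theorem top_eq : instTopD N =
    TopologicalSpace.generateFrom (Set.range fun p : List (Fin (N + 3)) × Fin (N + 3) =>
      (HS p.1 p.2 : Set (D N))) := by
  generalize hT' : TopologicalSpace.generateFrom (Set.range
    fun p : List (Fin (N + 3)) × Fin (N + 3) => (HS p.1 p.2 : Set (D N))) = T'
  have hle : instTopD N ≤ T' := by
    rw [← hT']
    refine le_generateFrom ?_
    rintro _ ⟨p, rfl⟩
    exact HS_open p.1 p.2
  have ho : ∀ w i, IsOpen[T'] (HS w i : Set (D N)) := fun w i => by
    rw [← hT']
    exact TopologicalSpace.isOpen_generateFrom_of_mem ⟨(w, i), rfl⟩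
  have h2 : @T2Space (D N) T' := by
    refine @T2Space.mk _ T' fun x y hxy => ?_
    obtain ⟨w, i, j, hij, hx, hy⟩ := sep hxy
    exact ⟨_, _, ho w i, ho w j, hx, hy, HS_disjoint hij⟩
  have hc : @Continuous _ _ (instTopD N) T' (Equiv.refl (D N)) := continuous_id_iff_le.2 hle
  let e := @Continuous.homeoOfEquivCompactToT2 _ _ (instTopD N) T' inferInstance h2
    (Equiv.refl (D N)) hc
  exact le_antisymm hle
    (continuous_id_iff_le.1 (@Homeomorph.continuous_symm _ _ (instTopD N) T' e))

instance : SecondCountableTopology (D N) :=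
  ⟨⟨_, Set.countable_range _, top_eq⟩⟩

end Wz


namespace Wz
variable {N : ℕ}

/-- Cylinders. -/
def cyl (z : Wd N) (k : ℕ) : Set (Wd N) := {z' | ∀ j, j < k → z j = z' j}

theorem cyl_open (z : Wd N) (k : ℕ) : IsOpen (cyl z k) := by
  have : cyl z k = Set.pi (Set.Iio k) fun j => {z j} := by
    ext z'
    simp only [cyl, Set.mem_ofPred_eq, Set.mem_pi, Set.mem_Iio, Set.mem_singleton_iff]
    exact ⟨fun h j hj => (h j hj).symm, fun h j hj => (h j hj).symm⟩
  rw [this]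
  exact isOpen_set_pi (Set.finite_Iio k) fun _ _ => isOpen_discrete _

theorem mem_cyl (z : Wd N) (k : ℕ) : z ∈ cyl z k := fun _ _ => rfl

theorem exists_cyl {V : Set (Wd N)} (hV : IsOpen V) {z : Wd N} (hz : z ∈ V) :
    ∃ k, cyl z k ⊆ V := by
  obtain ⟨I, u, h1, h2⟩ := isOpen_pi_iff.1 hV z hz
  refine ⟨I.sup id + 1, fun z' hz' => h2 fun j hj => ?_⟩
  rw [← hz' j (Nat.lt_succ_of_le (Finset.le_sup (f := id) hj))]
  exact (h1 j hj).2

theorem exists_depth {S V : Set (Wd N)} (hS : IsCompact S) (hV : IsOpen V) (h : S ⊆ V) :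
    ∃ k, ∀ z ∈ S, cyl z k ⊆ V := by
  refine hS.induction_on (p := fun T => ∃ k, ∀ z ∈ T, cyl z k ⊆ V) ?_ ?_ ?_ ?_
  · exact ⟨0, fun z hz => absurd hz (Set.notMem_empty z)⟩
  · rintro s t hst ⟨k, hk⟩
    exact ⟨k, fun z hz => hk z (hst hz)⟩
  · rintro s t ⟨k, hk⟩ ⟨l, hl⟩
    refine ⟨max k l, fun z hz => ?_⟩
    rcases hz with hz | hz
    · exact fun z' hz' => hk z hz fun j hj => hz' j (lt_of_lt_of_le hj (le_max_left _ _))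
    · exact fun z' hz' => hl z hz fun j hj => hz' j (lt_of_lt_of_le hj (le_max_right _ _))
  · intro z hz
    obtain ⟨k, hk⟩ := exists_cyl hV (h hz)
    refine ⟨cyl z k, mem_nhdsWithin_of_mem_nhds ((cyl_open z k).mem_nhds (mem_cyl z k)), k, ?_⟩
    intro z' hz' z'' hz''
    exact hk fun j hj => (hz' j hj).trans (hz'' j hj)

theorem const_aux (k : ℕ) : ∀ f : D N → Bool,
    (∀ z z' : Wd N, (∀ j, j < k → z j = z' j) → f (pr z) = f (pr z')) → ∀ x, f x = f m := by
  induction k with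
  | zero =>
    intro f hf x
    obtain ⟨z, rfl⟩ := pr_surj x
    obtain ⟨z', hz'⟩ := pr_surj (m : D N)
    rw [← hz']
    exact hf z z' (by simp)
  | succ k ih =>
    intro f hf x
    obtain ⟨i, y, rfl⟩ := phi_surj x
    have h := ih (fun y => f (phi i y)) (fun z z' hz => by
      rw [phi_pr, phi_pr]
      refine hf _ _ fun j hj => ?_
      cases j with
      | zero => rfl
      | succ j => exact hz j (by omega))
    have h1 := h y
    have h2 := h a
    rw [h1, ← h2, phi_a]

instance : PreconnectedSpace (D N) := by
  refine preconnectedSpace_of_forall_constant fun {f} hf => ?_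
  have key : ∀ x, f x = f m := by
    have hc : Continuous (fun z => f (pr z)) := hf.comp pr_cont
    have hop : ∀ c : Bool, IsClopen {z | f (pr z) = c} := fun c =>
      (isClopen_discrete {c}).preimage hc
    obtain ⟨k, hk⟩ := exists_depth (hop true).isClosed.isCompact (hop true).isOpen subset_rfl
    obtain ⟨l, hl⟩ := exists_depth (hop false).isClosed.isCompact (hop false).isOpen subset_rfl
    refine const_aux (max k l) f fun z z' h => ?_
    cases hz : f (pr z) with
    | true => exact (hk z hz fun j hj => h j (lt_of_lt_of_le hj (le_max_left _ _))).symm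
    | false => exact (hl z hz fun j hj => h j (lt_of_lt_of_le hj (le_max_right _ _))).symm
  intro x y
  rw [key x, key y]

instance : Nonempty (D N) := ⟨m⟩

instance : ConnectedSpace (D N) := ⟨inferInstance⟩

/-- Prefixes. -/
def pre : Wd N → ℕ → List (Fin (N + 3))
  | _, 0 => []
  | z, k + 1 => z 0 :: pre (wtail z) k

theorem mem_cell (k : ℕ) : ∀ (z : Wd N) (y : D N),
    y ∈ Set.range (phiw (pre z k)) ↔ ∃ z' ∈ cyl z k, pr z' = y := by
  induction k with
  | zero =>
    intro z y
    obtain ⟨z', rfl⟩ := pr_surj y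
    exact ⟨fun _ => ⟨z', by simp [cyl], rfl⟩, fun _ => ⟨_, rfl⟩⟩
  | succ k ih =>
    intro z y
    constructor
    · rintro ⟨x, rfl⟩
      obtain ⟨z', h1, h2⟩ := (ih (wtail z) _).1 ⟨x, rfl⟩
      refine ⟨wcons (z 0) z', fun j hj => ?_, ?_⟩
      · cases j with
        | zero => rfl
        | succ j => exact h1 j (by omega)
      · rw [← phi_pr, h2]; rfl
    · rintro ⟨z', h1, rfl⟩
      obtain ⟨x, hx⟩ := (ih (wtail z) (pr (wtail z'))).2
        ⟨wtail z', fun j hj => h1 (j + 1) (by omega), rfl⟩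
      refine ⟨x, ?_⟩
      rw [pre, phiw, hx, pr_cons z', h1 0 (by omega)]

theorem cell_preconnected (w : List (Fin (N + 3))) :
    IsPreconnected (Set.range (phiw w : D N → D N)) := isPreconnected_range (phiw_cont w)

theorem cell1_preconnected (i : Fin (N + 3)) :
    IsPreconnected (Set.range (phi i : D N → D N)) := isPreconnected_range (phi_cont i)

theorem m_mem_cell1 (i : Fin (N + 3)) : (m : D N) ∈ Set.range (phi i) := ⟨a, phi_a i⟩

instance : LocallyConnectedSpace (D N) := by
  rw [locallyConnectedSpace_iff_connected_subsets]
  intro x O' hO'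
  obtain ⟨O, hOO', hO, hx⟩ := mem_nhds_iff.1 hO'
  have hKc : IsCompact (pr ⁻¹' {x} : Set (Wd N)) := (isClosed_singleton.preimage pr_cont).isCompact
  obtain ⟨k, hk⟩ := exists_depth hKc (hO.preimage pr_cont) (by
    intro z hz
    rw [Set.mem_preimage, Set.mem_singleton_iff] at hz
    rw [Set.mem_preimage, hz]; exact hx)
  refine ⟨⋃ z : (pr ⁻¹' {x} : Set (Wd N)), Set.range (phiw (pre z.1 k)), ?_, ?_, ?_⟩
  · have hTo : IsOpen (⋃ z : (pr ⁻¹' {x} : Set (Wd N)), cyl z.1 k) :=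
      isOpen_iUnion fun z => cyl_open z.1 k
    have hTc : IsClosed (pr '' (⋃ z : (pr ⁻¹' {x} : Set (Wd N)), cyl z.1 k)ᶜ) :=
      ((hTo.isClosed_compl).isCompact.image pr_cont).isClosed
    refine Filter.mem_of_superset (hTc.isOpen_compl.mem_nhds ?_) ?_
    · rintro ⟨z, hz, hzx⟩
      exact hz (Set.mem_iUnion.2 ⟨⟨z, hzx⟩, mem_cyl z k⟩)
    · intro y hy
      obtain ⟨z, rfl⟩ := pr_surj y
      have : z ∈ ⋃ z : (pr ⁻¹' {x} : Set (Wd N)), cyl z.1 k := by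
        by_contra hc
        exact hy ⟨z, hc, rfl⟩
      obtain ⟨z0, hz0⟩ := Set.mem_iUnion.1 this
      exact Set.mem_iUnion.2 ⟨z0, (mem_cell k _ _).2 ⟨z, hz0, rfl⟩⟩
  · refine isPreconnected_iUnion ⟨x, ?_⟩ fun z => cell_preconnected _
    rw [Set.mem_iInter]
    rintro ⟨z, hz⟩
    exact (mem_cell k _ _).2 ⟨z, mem_cyl z k, hz⟩
  · refine Set.iUnion_subset ?_
    rintro ⟨z, hz⟩ y hy
    obtain ⟨z', h1, rfl⟩ := (mem_cell k _ _).1 hy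
    exact hOO' (hk z hz h1)

/-! Connectedness of half-spaces -/

theorem join_b_aux (k : ℕ) : ∀ z : Wd N, z k ≠ 1 →
    ∃ T : Set (D N), IsPreconnected T ∧ m ∈ T ∧ pr z ∈ T ∧ b ∉ T := by
  have key : ∀ z : Wd N, z 0 ≠ 1 →
      ∃ T : Set (D N), IsPreconnected T ∧ m ∈ T ∧ pr z ∈ T ∧ b ∉ T := by
    intro z hz
    refine ⟨Set.range (phi (z 0)), cell1_preconnected _, m_mem_cell1 _, ?_, ?_⟩
    · rw [pr_cons z]; exact ⟨_, rfl⟩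
    · rintro ⟨y, hy⟩
      exact hz (phi_eq_b.1 hy).1
  induction k with
  | zero => exact key
  | succ k ih =>
    intro z hz
    by_cases h : z 0 = 1
    · obtain ⟨T, hT, hm, hx, hb⟩ := ih (wtail z) hz
      refine ⟨phi 1 '' T ∪ Set.range (phiw [1, 0]), ?_, ?_, ?_, ?_⟩
      · refine IsPreconnected.union (phi 1 m) ⟨m, hm, rfl⟩ ⟨a, rfl⟩
          (hT.image _ (phi_cont 1).continuousOn) (cell_preconnected _)
      · refine Or.inr ⟨b, ?_⟩
        rw [phiw, phiw, phiw, phi_zero_b, phi_a]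
      · rw [pr_cons z, h]
        exact Or.inl ⟨_, hx, rfl⟩
      · rintro (⟨y, hy, e⟩ | ⟨y, e⟩)
        · rw [(phi_eq_b.1 e).2] at hy; exact hb hy
        · have := (phi_eq_b.1 (phi_eq_b.1 e).2).1
          simp at this
    · exact key z h

theorem compl_b_preconnected : IsPreconnected ({b}ᶜ : Set (D N)) := by
  refine isPreconnected_of_forall m fun x hx => ?_
  obtain ⟨z, rfl⟩ := pr_surj x
  obtain ⟨k, hk⟩ := ne_b_exists hx
  obtain ⟨T, h1, h2, h3, h4⟩ := join_b_aux k z hk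
  exact ⟨T, fun y hy e => h4 (e ▸ hy), h2, h3, h1⟩

theorem compl_a_preconnected : IsPreconnected ({a}ᶜ : Set (D N)) := by
  refine isPreconnected_of_forall m fun x hx => ?_
  obtain ⟨i, y, rfl⟩ := phi_surj x
  by_cases hi : i = 0
  · subst hi
    refine ⟨phi 0 '' {b}ᶜ, ?_, ⟨a, a_ne_b, rfl⟩, ⟨y, ?_, rfl⟩,
      compl_b_preconnected.image _ (phi_cont 0).continuousOn⟩
    · rintro _ ⟨y, hy, rfl⟩ e
      exact hy (phi_eq_a.1 e).2
    · intro e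
      rw [Set.mem_singleton_iff] at e
      exact hx (by rw [e, phi_zero_b]; rfl)
  · refine ⟨Set.range (phi i), ?_, m_mem_cell1 i, ⟨y, rfl⟩, cell1_preconnected i⟩
    rintro _ ⟨y, rfl⟩ e
    exact hi (phi_eq_a.1 e).1

theorem U_preconnected (i : Fin (N + 3)) : IsPreconnected (U i : Set (D N)) :=
  compl_a_preconnected.image _ (phi_cont i).continuousOn

theorem HS_preconnected (w : List (Fin (N + 3))) (i : Fin (N + 3)) :
    IsPreconnected (HS w i : Set (D N)) := by
  induction w with
  | nil => exact U_preconnected i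
  | cons j w ih =>
    have h1 : IsPreconnected (phi j '' HS w i) := ih.image _ (phi_cont j).continuousOn
    by_cases ha : a ∈ HS w i
    · refine isPreconnected_of_forall m fun x hx => ?_
      obtain ⟨k, y, rfl⟩ := phi_surj x
      by_cases hk : k = j
      · subst hk
        refine ⟨phi k '' HS w i, ?_, ⟨a, ha, phi_a k⟩, ⟨y, ?_, rfl⟩, h1⟩
        · rintro _ ⟨y, hy, rfl⟩
          change colw w (col k (phi k y)) ∈ U i
          rw [col_phi_self]; exact hy
        · change colw w (col k (phi k y)) ∈ U i at hx
          rw [col_phi_self] at hx; exact hx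
      · refine ⟨Set.range (phi k), ?_, m_mem_cell1 k, ⟨y, rfl⟩, cell1_preconnected k⟩
        rintro _ ⟨y, rfl⟩
        change colw w (col j (phi k y)) ∈ U i
        rw [col_phi_ne hk]; exact ha
    · have : HS (j :: w) i = phi j '' HS w i := by
        ext x
        constructor
        · intro hx
          refine ⟨col j x, hx, phi_col fun e => ha ?_⟩
          rw [← e]; exact hx
        · rintro ⟨y, hy, rfl⟩
          change colw w (col j (phi j y)) ∈ U i
          rw [col_phi_self]; exact hy
      rw [this]; exact h1

theorem mw_mem_HS (w : List (Fin (N + 3))) (i : Fin (N + 3)) : mw (w ++ [i]) ∈ HS w i := by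
  change colw w (phiw (w ++ [i]) m) ∈ U i
  rw [phiw_append, colw_phiw]
  exact phi_mem_U.2 ⟨rfl, m_ne_a⟩

/-! Orders of points -/

theorem ptOrder_mw (w : List (Fin (N + 3))) : ptOrder (D N) (mw w) = N + 3 := by
  have hcomp : ∀ i x, x ∈ HS w i → connectedComponentIn ({mw w}ᶜ : Set (D N)) x = HS w i := by
    intro i x hx
    apply le_antisymm
    · refine sub_HS isPreconnected_connectedComponentIn ?_ (mem_connectedComponentIn ?_) hx
      · exact fun h => connectedComponentIn_subset _ _ h rfl
      · rintro rfl; exact mw_not_mem_HS w i hx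
    · refine (HS_preconnected w i).subset_connectedComponentIn hx ?_
      rintro y hy rfl
      exact mw_not_mem_HS w i hy
  have : setComponents (D N) {mw w}ᶜ = Set.range (HS w) := by
    ext C
    constructor
    · rintro ⟨x, hx, rfl⟩
      obtain ⟨i, hi⟩ := mem_HS_of_ne hx
      exact ⟨i, (hcomp i x hi).symm⟩
    · rintro ⟨i, rfl⟩
      refine ⟨mw (w ++ [i]), ?_, (hcomp i _ (mw_mem_HS w i)).symm⟩
      intro e
      rw [Set.mem_singleton_iff] at e
      have := mw_mem_HS w i
      rw [e] at this
      exact mw_not_mem_HS w i this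
  rw [ptOrder, this, ← Set.image_univ, Set.ncard_image_of_injective]
  · simp [Set.ncard_univ]
  · intro i j h
    have := mw_mem_HS w i
    rw [h] at this
    exact HS_unique (mw_mem_HS w i) this

theorem phiw_eq_b {w : List (Fin (N + 3))} {y : D N} (h : phiw w y = b) : y = b := by
  induction w with
  | nil => exact h
  | cons i w ih => exact ih (phi_eq_b.1 h).2

theorem join_cell (w : List (Fin (N + 3))) : ∀ y : D N, y ∉ Set.range (phiw w) →
    ∃ (S : Set (D N)) (c : D N), IsPreconnected S ∧ y ∈ S ∧ (c = a ∨ c = b) ∧ phiw w c ∈ S ∧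
      (∃ v, phiw w c = mw v) ∧ ∀ x, phiw w x ∈ S → phiw w x = phiw w c := by
  induction w with
  | nil => exact fun y hy => absurd ⟨y, rfl⟩ hy
  | cons i w ih =>
    intro y hy
    obtain ⟨j, y, rfl⟩ := phi_surj y
    by_cases hj : j = i
    · subst hj
      obtain ⟨S, c, h1, h2, h3, h4, ⟨v, hv⟩, h5⟩ := ih y (by
        rintro ⟨x, rfl⟩; exact hy ⟨x, rfl⟩)
      refine ⟨phi j '' S, c, h1.image _ (phi_cont j).continuousOn, ⟨y, h2, rfl⟩, h3,
        ⟨_, h4, rfl⟩, ⟨j :: v, ?_⟩, ?_⟩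
      · rw [phiw, hv]; rfl
      · rintro x ⟨s, hs, e⟩
        have e' := phi_inj j e
        subst e'
        rw [phiw, phiw, h5 x hs]
    · by_cases ha : a ∈ Set.range (phiw w : D N → D N)
      · obtain ⟨c, hc⟩ := ha
        refine ⟨Set.range (phi j), c, cell1_preconnected j, ⟨y, rfl⟩, ?_, ?_, ⟨[], ?_⟩, ?_⟩
        · cases w with
          | nil => exact Or.inl hc
          | cons k w => exact Or.inr (phiw_eq_b (phi_eq_a.1 hc).2)
        · rw [phiw, hc, phi_a]; exact m_mem_cell1 j
        · rw [phiw, hc, phi_a]; rfl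
        · rintro x ⟨s, hs⟩
          rw [phiw] at hs ⊢
          rcases phi_eq.1 hs with h | h
          · exact absurd h.1 hj
          · rw [phiw, hc, h.2]
      · obtain ⟨S, c, h1, h2, h3, h4, ⟨v, hv⟩, h5⟩ := ih a ha
        refine ⟨phi i '' S ∪ Set.range (phi j), c, ?_, Or.inr ⟨y, rfl⟩, h3,
          Or.inl ⟨_, h4, rfl⟩, ⟨i :: v, ?_⟩, ?_⟩
        · exact IsPreconnected.union m ⟨a, h2, phi_a i⟩ (m_mem_cell1 j)
            (h1.image _ (phi_cont i).continuousOn) (cell1_preconnected j)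
        · rw [phiw, hv]; rfl
        · rintro x (⟨s, hs, e⟩ | ⟨s, hs⟩)
          · have e' := phi_inj i e
            subst e'
            rw [phiw, phiw, h5 x hs]
          · rw [phiw] at hs
            rcases phi_eq.1 hs with h | h
            · exact absurd h.1 hj
            · exact absurd ⟨x, h.2⟩ ha

def Joined (x y y' : D N) : Prop := ∃ T : Set (D N), IsPreconnected T ∧ y ∈ T ∧ y' ∈ T ∧ x ∉ T

theorem exists_not_mem_cell {z : Wd N} {y : D N} (h : y ≠ pr z) :
    ∃ k, ∀ l, k ≤ l → y ∉ Set.range (phiw (pre z l)) := by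
  obtain ⟨k, hk⟩ := exists_cyl (V := pr ⁻¹' {y}ᶜ) (isOpen_compl_singleton.preimage pr_cont)
    (z := z) (fun e => h e.symm)
  refine ⟨k, fun l hl hc => ?_⟩
  obtain ⟨z', h1, h2⟩ := (mem_cell l z y).1 hc
  exact hk (fun j hj => h1 j (lt_of_lt_of_le hj hl)) h2

theorem nonbranch_joined {x : D N} (hx : ∀ v, x ≠ mw v) (y : Fin 3 → D N) (hy : ∀ t, y t ≠ x) :
    ∃ t t', t ≠ t' ∧ Joined x (y t) (y t') := by
  obtain ⟨z, rfl⟩ := pr_surj x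
  choose k hk using fun t => exists_not_mem_cell (hy t)
  set l := Finset.univ.sup k with hl
  have hl' : ∀ t, y t ∉ Set.range (phiw (pre z l)) := fun t =>
    hk t l (Finset.le_sup (f := k) (Finset.mem_univ t))
  choose S c h1 h2 h3 h4 h5 h6 using fun t => join_cell _ _ (hl' t)
  have hnot : ∀ t, pr z ∉ S t := by
    intro t ht
    obtain ⟨x, hx'⟩ := (mem_cell l z (pr z)).2 ⟨z, mem_cyl z l, rfl⟩
    rw [← hx'] at ht
    have := h6 t x ht
    rw [hx'] at this
    obtain ⟨v, hv⟩ := h5 t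
    exact hx v (this.trans hv)
  have : ∃ t t' : Fin 3, t ≠ t' ∧ c t = c t' := by
    rcases h3 0 with e0 | e0 <;> rcases h3 1 with e1 | e1 <;> rcases h3 2 with e2 | e2
    · exact ⟨0, 1, by simp, by rw [e0, e1]⟩
    · exact ⟨0, 1, by simp, by rw [e0, e1]⟩
    · exact ⟨0, 2, by simp, by rw [e0, e2]⟩
    · exact ⟨1, 2, by simp, by rw [e1, e2]⟩
    · exact ⟨1, 2, by simp, by rw [e1, e2]⟩
    · exact ⟨0, 2, by simp, by rw [e0, e2]⟩
    · exact ⟨0, 1, by simp, by rw [e0, e1]⟩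
    · exact ⟨0, 1, by simp, by rw [e0, e1]⟩
  obtain ⟨t, t', htt, hc⟩ := this
  refine ⟨t, t', htt, S t ∪ S t', ?_, Or.inl (h2 t), Or.inr (h2 t'), ?_⟩
  · exact IsPreconnected.union _ (h4 t) (hc ▸ h4 t') (h1 t) (h1 t')
  · rintro (h | h)
    · exact hnot t h
    · exact hnot t' h

theorem ptOrder_nonbranch {x : D N} (hx : ∀ v, x ≠ mw v) :
    ptOrder (D N) x = 1 ∨ ptOrder (D N) x = 2 := by
  have hne : (setComponents (D N) {x}ᶜ).Nonempty := ⟨_, m, (hx []).symm, rfl⟩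
  have hle : (setComponents (D N) {x}ᶜ).encard ≤ 2 := by
    by_contra hc
    rw [not_le] at hc
    have h3 : 3 ≤ (setComponents (D N) {x}ᶜ).encard := by
      have := Order.add_one_le_of_lt hc
      norm_num at this
      exact this
    obtain ⟨t, ht, ht3⟩ := Set.exists_subset_encard_eq h3
    obtain ⟨A, B, C, hAB, hAC, hBC, rfl⟩ := Set.encard_eq_three.1 ht3
    obtain ⟨y0, hy0, rfl⟩ := ht (show A ∈ _ by simp)
    obtain ⟨y1, hy1, rfl⟩ := ht (show B ∈ _ by simp)
    obtain ⟨y2, hy2, rfl⟩ := ht (show C ∈ _ by simp)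
    have hJ : ∀ y y', Joined x y y' →
        connectedComponentIn {x}ᶜ y = connectedComponentIn {x}ᶜ y' := by
      rintro y y' ⟨T, hT, h1, h2, h3⟩
      have hsub : T ⊆ {x}ᶜ := fun u hu e => h3 (e ▸ hu)
      exact connectedComponentIn_eq (hT.subset_connectedComponentIn h1 hsub h2)
    obtain ⟨t, t', htt, hj⟩ := nonbranch_joined hx ![y0, y1, y2] (by
      intro t; fin_cases t <;> assumption)
    have := hJ _ _ hj
    fin_cases t <;> fin_cases t' <;> simp_all
  have hfin : (setComponents (D N) {x}ᶜ).Finite :=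
    Set.finite_of_encard_le_coe (k := 2) (by exact_mod_cast hle)
  have h1 : 0 < ptOrder (D N) x := (Set.ncard_pos hfin).2 hne
  have h2 : ptOrder (D N) x ≤ 2 := by
    rw [← hfin.cast_ncard_eq] at hle
    exact_mod_cast hle
  omega

/-! No circles, arcs -/

theorem circle_compl_preconnected (c : Circle) : IsPreconnected ({c}ᶜ : Set Circle) := by
  obtain ⟨t, rfl⟩ : ∃ t, Circle.exp t = c := ⟨_, Circle.exp_arg c⟩
  have : ({Circle.exp t}ᶜ : Set Circle) = Circle.exp '' Set.Ioo t (t + 2 * Real.pi) := by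
    ext d
    constructor
    · intro hd
      obtain ⟨s, rfl⟩ : ∃ s, Circle.exp s = d := ⟨_, Circle.exp_arg d⟩
      have hs := toIcoMod_mem_Ico Real.two_pi_pos t s
      have hse : Circle.exp (toIcoMod Real.two_pi_pos t s) = Circle.exp s := by
        rw [Circle.exp_eq_exp]
        refine ⟨-toIcoDiv Real.two_pi_pos t s, ?_⟩
        have := toIcoMod_add_toIcoDiv_zsmul Real.two_pi_pos t s
        rw [zsmul_eq_mul] at this
        push_cast
        linarith
      refine ⟨_, ⟨lt_of_le_of_ne hs.1 ?_, hs.2⟩, hse⟩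
      intro e
      rw [← e] at hse
      exact hd hse.symm
    · rintro ⟨s, hs, rfl⟩ e
      rw [Set.mem_singleton_iff, Circle.exp_eq_exp] at e
      obtain ⟨k, hk⟩ := e
      have hp := Real.two_pi_pos
      have h1 : (0 : ℝ) < k := by
        by_contra hc
        nlinarith [hs.1]
      have h2 : (k : ℝ) < 1 := by
        by_contra hc
        nlinarith [hs.2]
      have h1' : (0 : ℤ) < k := by exact_mod_cast h1
      have h2' : k < 1 := by exact_mod_cast h2
      omega
  rw [this]
  exact isPreconnected_Ioo.image _ Circle.exp.continuous.continuousOn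

theorem no_circle (S : Set (D N)) : IsEmpty (S ≃ₜ Circle) := by
  refine ⟨fun e => ?_⟩
  have hne : (e.symm 1).1 ≠ (e.symm (-1)).1 := by
    intro h
    have h1 := e.symm.injective (Subtype.ext h)
    have h2 := congrArg (fun c : Circle => (c : ℂ)) h1
    simp only [Circle.coe_neg, Circle.coe_one] at h2
    have h3 := congrArg Complex.re h2
    norm_num at h3
  obtain ⟨w, i, j, hij, hx, hy⟩ := sep hne
  have hcont : Continuous (fun c => (e.symm c).1) := continuous_subtype_val.comp e.symm.continuous
  obtain ⟨T, hT, hTm, h1, h2⟩ : ∃ T : Set Circle, IsPreconnected T ∧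
      (∀ c ∈ T, (e.symm c).1 ≠ mw w) ∧ 1 ∈ T ∧ -1 ∈ T := by
    by_cases hm : mw w ∈ S
    · refine ⟨{e ⟨mw w, hm⟩}ᶜ, circle_compl_preconnected _, ?_, ?_, ?_⟩
      · intro c hc h
        apply hc
        rw [Set.mem_singleton_iff, ← e.apply_symm_apply c]
        congr 1
        exact Subtype.ext h
      · intro h
        rw [Set.mem_singleton_iff] at h
        rw [h, e.symm_apply_apply] at hx
        exact mw_not_mem_HS w i hx
      · intro h
        rw [Set.mem_singleton_iff] at h
        rw [h, e.symm_apply_apply] at hy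
        exact mw_not_mem_HS w j hy
    · refine ⟨Set.univ, ?_, fun c _ h => hm (h ▸ (e.symm c).2), trivial, trivial⟩
      have : (Set.univ : Set Circle) = Circle.exp '' Set.univ := by
        rw [Set.image_univ]
        exact (Set.range_eq_univ.2 fun c => ⟨_, Circle.exp_arg c⟩).symm
      rw [this]
      exact isPreconnected_univ.image _ Circle.exp.continuous.continuousOn
  have := sub_HS (hT.image _ hcont.continuousOn) (w := w)
    (by rintro ⟨c, hc, h⟩; exact hTm c hc h) ⟨1, h1, rfl⟩ hx ⟨-1, h2, rfl⟩
  exact hij (HS_unique this hy)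

theorem isWazewski (N : ℕ) : IsWazewskiDendrite (N + 3) (D N) := by
  refine ⟨⟨inferInstance, inferInstance, inferInstance, inferInstance, inferInstance, no_circle⟩,
    ?_, ?_⟩
  · intro x
    by_cases h : ∃ v, x = mw v
    · obtain ⟨v, rfl⟩ := h
      exact Or.inr (Or.inr (ptOrder_mw v))
    · rcases ptOrder_nonbranch (fun v hv => h ⟨v, hv⟩) with h | h
      · exact Or.inl h
      · exact Or.inr (Or.inl h)
  · rintro A ⟨e⟩
    have hne : (e.symm 0).1 ≠ (e.symm 1).1 := by
      intro h
      exact zero_ne_one (e.symm.injective (Subtype.ext h))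
    obtain ⟨w, i, j, hij, hx, hy⟩ := sep hne
    by_cases hm : mw w ∈ A
    · exact ⟨_, hm, ptOrder_mw w⟩
    · exfalso
      have hcont : Continuous (fun c => (e.symm c).1) :=
        continuous_subtype_val.comp e.symm.continuous
      have := sub_HS (isPreconnected_range hcont) (w := w)
        (by rintro ⟨c, h⟩; exact hm (h ▸ (e.symm c).2)) ⟨0, rfl⟩ hx ⟨1, rfl⟩
      exact hij (HS_unique this hy)

end Wz


namespace Wz
variable {N : ℕ}

abbrev K (N : ℕ) : Type := D N ≃ₜ D N

theorem mul_ap (f g : K N) (x : D N) : (f * g) x = f (g x) := rfl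
theorem one_ap (x : D N) : (1 : K N) x = x := rfl
theorem inv_ap (f : K N) (x : D N) : f⁻¹ (f x) = x := f.symm_apply_apply x
theorem ap_inv (f : K N) (x : D N) : f (f⁻¹ x) = x := f.apply_symm_apply x
theorem inv_eq {f : K N} {x y : D N} (h : f x = y) : f⁻¹ y = x := by rw [← h, inv_ap]
theorem K_ext {f g : K N} (h : ∀ i x, f (phi i x) = g (phi i x)) : f = g := by
  refine Homeomorph.ext fun x => ?_
  obtain ⟨i, y, rfl⟩ := phi_surj x
  exact h i y

def mkK (f g : D N → D N) (hf : Continuous f) (hg : Continuous g) (h1 : ∀ x, g (f x) = x)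
    (h2 : ∀ x, f (g x) = x) : K N where
  toFun := f
  invFun := g
  left_inv := h1
  right_inv := h2
  continuous_toFun := hf
  continuous_invFun := hg

/-- Permuting the branches at `m`. -/
def sigF (r : Equiv.Perm (Fin (N + 3))) : D N → D N :=
  glue (fun i => phi (r i)) (fun i j => by rw [phi_a, phi_a])

theorem sigF_phi (r : Equiv.Perm (Fin (N + 3))) (i : Fin (N + 3)) (x : D N) :
    sigF r (phi i x) = phi (r i) x := glue_phi _ _ i x

theorem sigF_inv (r r' : Equiv.Perm (Fin (N + 3))) (h : ∀ i, r' (r i) = i) (x : D N) :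
    sigF r' (sigF r x) = x := by
  obtain ⟨i, y, rfl⟩ := phi_surj x
  rw [sigF_phi, sigF_phi, h]

theorem sigF_cont (r : Equiv.Perm (Fin (N + 3))) : Continuous (sigF r) :=
  glue_cont _ _ fun i => phi_cont (r i)

def sig (r : Equiv.Perm (Fin (N + 3))) : K N :=
  mkK (sigF r) (sigF r.symm) (sigF_cont r) (sigF_cont _) (sigF_inv _ _ (by simp))
    (sigF_inv _ _ (by simp))

theorem sig_phi (r : Equiv.Perm (Fin (N + 3))) (i : Fin (N + 3)) (x : D N) :
    sig r (phi i x) = phi (r i) x := sigF_phi r i x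

theorem sig_m (r : Equiv.Perm (Fin (N + 3))) : sig r m = m := by
  conv_lhs => rw [← phi_a 0, sig_phi, phi_a]

theorem sig_a {r : Equiv.Perm (Fin (N + 3))} (h : r 0 = 0) : sig r a = a := by
  rw [← phi_zero_b, sig_phi, h]

def flp : K N := sig (Equiv.swap 0 1)

theorem flp_zero (x : D N) : flp (phi 0 x) = phi 1 x := by
  rw [flp, sig_phi, Equiv.swap_apply_left]
theorem flp_one (x : D N) : flp (phi 1 x) = phi 0 x := by
  rw [flp, sig_phi, Equiv.swap_apply_right]
theorem flp_ne {i : Fin (N + 3)} (h0 : i ≠ 0) (h1 : i ≠ 1) (x : D N) :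
    flp (phi i x) = phi i x := by
  rw [flp, sig_phi, Equiv.swap_apply_of_ne_of_ne h0 h1]
theorem flp_a : flp (a : D N) = b := by
  rw [← phi_zero_b, flp_zero, phi_one_b]
theorem flp_b : flp (b : D N) = a := by
  conv_lhs => rw [← phi_one_b, flp_one, phi_zero_b]
theorem flp_flp (x : D N) : flp (flp x) = x := by
  obtain ⟨i, y, rfl⟩ := phi_surj x
  rw [flp, sig_phi, sig_phi, Equiv.swap_apply_self]

/-- An involution exchanging `m` and `mw [0]`. -/
def rhoIn : D N → D N :=
  glue (fun j x => if j = 0 then phi 0 (phi 0 (flp x)) else phi j x) (by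
    have h : ∀ j : Fin (N + 3),
        (if j = 0 then phi 0 (phi 0 (flp a)) else phi j a) = (m : D N) := by
      intro j
      split_ifs
      · rw [flp_a, phi_zero_b, phi_a]
      · rw [phi_a]
    intro i j
    rw [h, h])

theorem rhoIn_zero (x : D N) : rhoIn (phi 0 x) = phi 0 (phi 0 (flp x)) := by
  rw [rhoIn, glue_phi, if_pos rfl]

theorem rhoIn_ne {j : Fin (N + 3)} (h : j ≠ 0) (x : D N) : rhoIn (phi j x) = phi j x := by
  rw [rhoIn, glue_phi, if_neg h]

theorem rhoIn_a : rhoIn (a : D N) = phi 0 m := by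
  rw [← phi_zero_b, rhoIn_zero, flp_b, phi_a]

theorem rhoIn_cont : Continuous (rhoIn : D N → D N) := by
  refine glue_cont _ _ fun j => ?_
  by_cases h : j = 0
  · simp only [h, if_true]
    exact (phi_cont 0).comp ((phi_cont 0).comp flp.continuous)
  · simp only [h, if_false]
    exact phi_cont j

def rhoF : D N → D N :=
  glue (fun i x => if i = 0 then rhoIn x else phi 0 (phi i x)) (by
    have h : ∀ i : Fin (N + 3),
        (if i = 0 then rhoIn a else phi 0 (phi i a)) = (phi 0 m : D N) := by
      intro i
      split_ifs
      · exact rhoIn_a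
      · rw [phi_a]
    intro i j
    rw [h, h])

theorem rhoF_ne {i : Fin (N + 3)} (h : i ≠ 0) (x : D N) : rhoF (phi i x) = phi 0 (phi i x) := by
  rw [rhoF, glue_phi, if_neg h]

theorem rhoF_zero_ne {i : Fin (N + 3)} (h : i ≠ 0) (x : D N) :
    rhoF (phi 0 (phi i x)) = phi i x := by
  rw [rhoF, glue_phi, if_pos rfl, rhoIn_ne h]

theorem rhoF_zero_zero (x : D N) : rhoF (phi 0 (phi 0 x)) = phi 0 (phi 0 (flp x)) := by
  rw [rhoF, glue_phi, if_pos rfl, rhoIn_zero]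

theorem rhoF_cont : Continuous (rhoF : D N → D N) := by
  refine glue_cont _ _ fun i => ?_
  by_cases h : i = 0
  · simp only [h, if_true]
    exact rhoIn_cont
  · simp only [h, if_false]
    exact (phi_cont 0).comp (phi_cont i)

theorem rhoF_rhoF (x : D N) : rhoF (rhoF x) = x := by
  obtain ⟨i, y, rfl⟩ := phi_surj x
  by_cases h : i = 0
  · subst h
    obtain ⟨j, y, rfl⟩ := phi_surj y
    by_cases hj : j = 0
    · subst hj
      rw [rhoF_zero_zero, rhoF_zero_zero, flp_flp]
    · rw [rhoF_zero_ne hj, rhoF_ne hj]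
  · rw [rhoF_ne h, rhoF_zero_ne h]

def rho : K N := mkK rhoF rhoF rhoF_cont rhoF_cont rhoF_rhoF rhoF_rhoF

/-- The hyperbolic element with axis from `a` to `b`. -/
def s : K N := flp * rho

theorem s_ne {i : Fin (N + 3)} (h : i ≠ 0) (x : D N) : s (phi i x) = phi 1 (phi i x) := by
  change flp (rhoF (phi i x)) = _
  rw [rhoF_ne h, flp_zero]

theorem s_zero_zero (x : D N) : s (phi 0 (phi 0 x)) = phi 1 (phi 0 (flp x)) := by
  change flp (rhoF _) = _
  rw [rhoF_zero_zero, flp_zero]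

theorem s_zero_one (x : D N) : s (phi 0 (phi 1 x)) = phi 0 x := by
  change flp (rhoF _) = _
  rw [rhoF_zero_ne (by simp), flp_one]

theorem s_zero_ne {i : Fin (N + 3)} (h0 : i ≠ 0) (h1 : i ≠ 1) (x : D N) :
    s (phi 0 (phi i x)) = phi i x := by
  change flp (rhoF _) = _
  rw [rhoF_zero_ne h0, flp_ne h0 h1]

theorem s_a : s (a : D N) = a := by
  conv_lhs => rw [← phi_zero_b, ← phi_one_b, s_zero_one, phi_zero_b]

theorem s_m : s (m : D N) = phi 1 m := by
  conv_lhs => rw [← phi_a 1, s_ne (by simp), phi_a]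

/-- Local action on the cells. -/
def locF (h : Fin (N + 3) → K N) (ha : ∀ i, h i a = a) : D N → D N :=
  glue (fun i x => phi i (h i x)) (fun i j => by rw [ha, ha, phi_a, phi_a])

def loc (h : Fin (N + 3) → K N) (ha : ∀ i, h i a = a) : K N :=
  mkK (locF h ha) (locF (fun i => (h i)⁻¹) fun i => inv_eq (ha i))
    (glue_cont _ _ fun i => (phi_cont i).comp (h i).continuous)
    (glue_cont _ _ fun i => (phi_cont i).comp (h i)⁻¹.continuous)
    (fun x => by
      obtain ⟨i, y, rfl⟩ := phi_surj x
      rw [locF, locF, glue_phi, glue_phi, inv_ap])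
    (fun x => by
      obtain ⟨i, y, rfl⟩ := phi_surj x
      rw [locF, locF, glue_phi, glue_phi, ap_inv])

theorem loc_phi (h : Fin (N + 3) → K N) (ha : ∀ i, h i a = a) (i : Fin (N + 3)) (x : D N) :
    loc h ha (phi i x) = phi i (h i x) := by
  change locF h ha (phi i x) = _
  rw [locF, glue_phi]

def IsLoc (i : Fin (N + 3)) (h g : K N) : Prop :=
  (∀ x, g (phi i x) = phi i (h x)) ∧ ∀ j, j ≠ i → ∀ x, g (phi j x) = phi j x

theorem IsLoc.mul {i : Fin (N + 3)} {h g h' g' : K N} (H : IsLoc i h g) (H' : IsLoc i h' g') :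
    IsLoc i (h * h') (g * g') := by
  refine ⟨fun x => ?_, fun j hj x => ?_⟩
  · rw [mul_ap, H'.1, H.1, mul_ap]
  · rw [mul_ap, H'.2 j hj, H.2 j hj]

theorem IsLoc.inv {i : Fin (N + 3)} {h g : K N} (H : IsLoc i h g) : IsLoc i h⁻¹ g⁻¹ := by
  refine ⟨fun x => inv_eq ?_, fun j hj x => inv_eq (H.2 j hj x)⟩
  rw [H.1, ap_inv]

def locS (i : Fin (N + 3)) (h : K N) (ha : h a = a) : K N :=
  loc (fun j => if j = i then h else 1) (fun j => by split_ifs <;> [exact ha; rfl])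

theorem locS_isLoc (i : Fin (N + 3)) (h : K N) (ha : h a = a) : IsLoc i h (locS i h ha) := by
  refine ⟨fun x => ?_, fun j hj x => ?_⟩
  · rw [locS, loc_phi, if_pos rfl]
  · rw [locS, loc_phi, if_neg hj]; rfl

def gens (N : ℕ) : Set (K N) :=
  (Set.range sig ∪ {s}) ∪ (Set.range (fun i => locS i s s_a) ∪
    Set.range (fun p : Fin (N + 3) × {r : Equiv.Perm (Fin (N + 3)) // r 0 = 0} =>
      locS p.1 (sig p.2.1) (sig_a p.2.2)))

theorem gens_finite : (gens N).Finite :=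
  ((Set.finite_range _).union (Set.finite_singleton _)).union
    ((Set.finite_range _).union (Set.finite_range _))

def G (N : ℕ) : Subgroup (K N) := Subgroup.closure (gens N)

theorem G_fg : (G N).FG :=
  (Subgroup.fg_iff _).2 ⟨gens N, rfl, gens_finite⟩

theorem sig_mem (r : Equiv.Perm (Fin (N + 3))) : sig r ∈ G N :=
  Subgroup.subset_closure (Or.inl (Or.inl ⟨r, rfl⟩))

theorem s_mem : s ∈ G N := Subgroup.subset_closure (Or.inl (Or.inr rfl))

/-- The rooted local group. -/
def H (N : ℕ) : Subgroup (K N) where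
  carrier := {h | h a = a ∧ ∀ i, ∃ g ∈ G N, IsLoc i h g}
  one_mem' := ⟨rfl, fun i => ⟨1, one_mem _, fun _ => rfl, fun _ _ _ => rfl⟩⟩
  mul_mem' := by
    rintro h h' ⟨ha, hl⟩ ⟨ha', hl'⟩
    refine ⟨by rw [mul_ap, ha', ha], fun i => ?_⟩
    obtain ⟨g, hg, hi⟩ := hl i
    obtain ⟨g', hg', hi'⟩ := hl' i
    exact ⟨g * g', mul_mem hg hg', hi.mul hi'⟩
  inv_mem' := by
    rintro h ⟨ha, hl⟩
    refine ⟨inv_eq ha, fun i => ?_⟩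
    obtain ⟨g, hg, hi⟩ := hl i
    exact ⟨g⁻¹, inv_mem hg, hi.inv⟩

theorem H_a {h : K N} (hh : h ∈ H N) : h a = a := hh.1

theorem s_mem_H : s ∈ H N := ⟨s_a, fun i => ⟨locS i s s_a,
  Subgroup.subset_closure (Or.inr (Or.inl ⟨i, rfl⟩)), locS_isLoc _ _ _⟩⟩

theorem sig_mem_H {r : Equiv.Perm (Fin (N + 3))} (hr : r 0 = 0) : sig r ∈ H N :=
  ⟨sig_a hr, fun i => ⟨locS i (sig r) (sig_a hr),
    Subgroup.subset_closure (Or.inr (Or.inr ⟨(i, ⟨r, hr⟩), rfl⟩)), locS_isLoc _ _ _⟩⟩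

theorem IsLoc.conj_sig {i : Fin (N + 3)} {h g : K N} (hl : IsLoc i h g)
    (r : Equiv.Perm (Fin (N + 3))) : IsLoc (r i) h (sig r * g * (sig r)⁻¹) := by
  have hinv : ∀ j x, (sig r)⁻¹ (phi j x) = phi (r.symm j) x := fun j x => by
    refine inv_eq ?_
    rw [sig_phi, Equiv.apply_symm_apply]
  refine ⟨fun x => ?_, fun j hj x => ?_⟩
  · rw [mul_ap, mul_ap, hinv, Equiv.symm_apply_apply, hl.1, sig_phi]
  · rw [mul_ap, mul_ap, hinv, hl.2, sig_phi, Equiv.apply_symm_apply]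
    rintro rfl
    simp at hj

theorem IsLoc.conj_s {h g g' : K N} (hl : IsLoc 1 h g) (hl' : IsLoc 1 g g') :
    g' = s * g * s⁻¹ := by
  have : g' * s = s * g := by
    refine K_ext fun i x => ?_
    rw [mul_ap, mul_ap]
    by_cases h0 : i = 0
    · subst h0
      rw [hl.2 0 (by simp)]
      obtain ⟨j, y, rfl⟩ := phi_surj x
      by_cases h1 : j = 0
      · subst h1
        rw [s_zero_zero, hl'.1, hl.2 0 (by simp)]
      · by_cases h2 : j = 1
        · subst h2
          rw [s_zero_one, hl'.2 0 (by simp)]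
        · rw [s_zero_ne h1 h2, hl'.2 j h2]
    · by_cases h1 : i = 1
      · subst h1
        rw [hl.1, s_ne (by simp), s_ne (by simp), hl'.1, hl.1]
      · rw [hl.2 i h1, s_ne h0, hl'.1, hl.2 i h1]
  rw [← this, mul_assoc, mul_inv_cancel, mul_one]

/-- Local copies of elements of `H` belong to `H`. -/
theorem loc_mem_H {h : K N} (hh : h ∈ H N) {i : Fin (N + 3)} (hi : i ≠ 0) :
    ∃ g ∈ H N, IsLoc i h g := by
  obtain ⟨g, hg, hl⟩ := hh.2 1
  have hga : g a = a := by
    rw [← phi_zero_b, hl.2 0 (by simp)]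
  have hgH : g ∈ H N := by
    refine ⟨hga, fun j => ?_⟩
    have hl' := locS_isLoc 1 g hga
    have hmem : locS 1 g hga ∈ G N := by
      rw [hl.conj_s hl']
      exact mul_mem (mul_mem s_mem hg) (inv_mem s_mem)
    have := hl'.conj_sig (Equiv.swap 1 j)
    rw [Equiv.swap_apply_left] at this
    exact ⟨_, mul_mem (mul_mem (sig_mem _) hmem) (inv_mem (sig_mem _)), this⟩
  have hsw : (Equiv.swap 1 i : Equiv.Perm (Fin (N + 3))) 0 = 0 :=
    Equiv.swap_apply_of_ne_of_ne (by simp) hi.symm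
  have := hl.conj_sig (Equiv.swap 1 i)
  rw [Equiv.swap_apply_left] at this
  exact ⟨_, mul_mem (mul_mem (sig_mem_H hsw) hgH) (inv_mem (sig_mem_H hsw)), this⟩

/-- The whole space minus the root component at `m`. -/
def C (N : ℕ) : Set (D N) := (U 0)ᶜ

theorem mem_C_iff {x : D N} : x ∈ C N ↔ ∃ i y, i ≠ 0 ∧ phi i y = x := by
  constructor
  · intro hx
    by_cases hm : x = m
    · exact ⟨1, a, by simp, by rw [hm, phi_a]⟩
    · obtain ⟨i, y, hy, rfl⟩ := mem_U_of_ne hm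
      refine ⟨i, y, ?_, rfl⟩
      rintro rfl
      exact hx (phi_mem_U.2 ⟨rfl, hy⟩)
  · rintro ⟨i, y, hi, rfl⟩ h
    exact hi (phi_mem_U.1 h).1

theorem phi_mem_C {i : Fin (N + 3)} (hi : i ≠ 0) (x : D N) : phi i x ∈ C N :=
  mem_C_iff.2 ⟨i, x, hi, rfl⟩

theorem s_C {x : D N} (hx : x ∈ C N) : s x = phi 1 x := by
  obtain ⟨i, y, hi, rfl⟩ := mem_C_iff.1 hx
  exact s_ne hi y

theorem flip_mw (w : List (Fin (N + 3))) :
    ∃ w' : List (Fin (N + 3)), w'.length = w.length ∧ flp (mw w) = mw w' := by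
  cases w with
  | nil => exact ⟨[], rfl, sig_m _⟩
  | cons i w =>
    refine ⟨Equiv.swap 0 1 i :: w, rfl, ?_⟩
    rw [mw_cons, mw_cons]
    exact sig_phi _ _ _

/-- Transitivity. -/
theorem trans_H (k : ℕ) : ∀ w : List (Fin (N + 3)), w.length ≤ k → ∃ g ∈ H N, g (mw w) = m := by
  induction k with
  | zero =>
    intro w hw
    rw [List.length_eq_zero_iff.1 (Nat.le_zero.1 hw)]
    exact ⟨1, one_mem _, rfl⟩
  | succ k ih =>
    have key : ∀ (i : Fin (N + 3)) (v : List (Fin (N + 3))), i ≠ 0 → v.length ≤ k →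
        ∃ g ∈ H N, g (phi i (mw v)) = m := by
      intro i v hi hv
      obtain ⟨h, hh, hm⟩ := ih v hv
      obtain ⟨g, hg, hl⟩ := loc_mem_H hh hi
      have hsw : (Equiv.swap 1 i : Equiv.Perm (Fin (N + 3))) 0 = 0 :=
        Equiv.swap_apply_of_ne_of_ne (by simp) hi.symm
      refine ⟨s⁻¹ * sig (Equiv.swap 1 i) * g,
        mul_mem (mul_mem (inv_mem s_mem_H) (sig_mem_H hsw)) hg, ?_⟩
      rw [mul_ap, hl.1, hm, mul_ap, sig_phi, Equiv.swap_apply_right]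
      exact inv_eq s_m
    intro w hw
    cases w with
    | nil => exact ⟨1, one_mem _, rfl⟩
    | cons i v =>
      rw [List.length_cons] at hw
      by_cases hi : i = 0
      · subst hi
        cases v with
        | nil =>
          refine ⟨s, s_mem_H, ?_⟩
          rw [mw_cons, mw_nil]
          conv_lhs => rw [← phi_a 1, s_zero_one, phi_a]
        | cons j u =>
          rw [List.length_cons] at hw
          by_cases h0 : j = 0
          · subst h0
            obtain ⟨u', hu', e⟩ := flip_mw u
            obtain ⟨g, hg, hgm⟩ := key 1 (0 :: u') (by simp) (by rw [List.length_cons]; omega)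
            refine ⟨g * s, mul_mem hg s_mem_H, ?_⟩
            rw [mul_ap, mw_cons, mw_cons, s_zero_zero, e]
            exact hgm
          · by_cases h1 : j = 1
            · subst h1
              obtain ⟨g, hg, hgm⟩ := ih (0 :: u) (by rw [List.length_cons]; omega)
              refine ⟨g * s, mul_mem hg s_mem_H, ?_⟩
              rw [mul_ap, mw_cons, mw_cons, s_zero_one]
              exact hgm
            · obtain ⟨g, hg, hgm⟩ := ih (j :: u) (by rw [List.length_cons]; omega)
              refine ⟨g * s, mul_mem hg s_mem_H, ?_⟩
              rw [mul_ap, mw_cons, mw_cons, s_zero_ne h0 h1]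
              exact hgm
      · exact key i v hi (by omega)

theorem trans_G (w : List (Fin (N + 3))) : ∃ g ∈ G N, g (mw w) = m := by
  cases w with
  | nil => exact ⟨1, one_mem _, rfl⟩
  | cons i v =>
    obtain ⟨h, hh, hm⟩ := trans_H v.length v le_rfl
    obtain ⟨g, hg, hl⟩ := hh.2 i
    refine ⟨s⁻¹ * sig (Equiv.swap 1 i) * g,
      mul_mem (mul_mem (inv_mem s_mem) (sig_mem _)) hg, ?_⟩
    rw [mul_ap, mw_cons, hl.1, hm, mul_ap, sig_phi, Equiv.swap_apply_right]
    exact inv_eq s_m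

end Wz


namespace Wz
variable {N : ℕ}

def Br (x : D N) : Prop := ∃ w, x = mw w

theorem Br_mw (w : List (Fin (N + 3))) : Br (mw w) := ⟨w, rfl⟩

theorem pre_img {T : Set (D N)} (hT : IsPreconnected T) (f : K N) : IsPreconnected (f '' T) :=
  hT.image f f.continuous.continuousOn

theorem Br_map (f : K N) {x : D N} (hx : Br x) : Br (f x) := by
  obtain ⟨w, rfl⟩ := hx
  by_contra hn
  have hn' : ∀ v, f (mw w) ≠ mw v := fun v e => hn ⟨v, e⟩
  let c : Fin 3 → Fin (N + 3) := Fin.castLE (by omega)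
  have hc : Function.Injective c := Fin.castLE_injective _
  obtain ⟨t, t', htt, T, hT, h1, h2, h3⟩ := nonbranch_joined hn' (fun t => f (mw (w ++ [c t])))
    (fun t e => mw_not_mem_HS w (c t) (f.injective e ▸ mw_mem_HS w (c t)))
  have hT' := pre_img hT f⁻¹
  have hm : mw w ∉ (f⁻¹ : K N) '' T := by
    rintro ⟨y, hy, e⟩
    rw [← e, ap_inv] at h3
    exact h3 hy
  have hs := sub_HS hT' hm ⟨_, h1, inv_ap f _⟩ (mw_mem_HS w (c t))
  exact htt (hc (HS_unique (hs ⟨_, h2, inv_ap f _⟩) (mw_mem_HS w (c t')))) 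

theorem Br_col {x : D N} {i : Fin (N + 3)} (hx : Br x) (h : x ∈ U i) : Br (col i x) := by
  obtain ⟨w, rfl⟩ := hx
  cases w with
  | nil => exact absurd h (m_not_mem_U i)
  | cons j v =>
    rw [mw_cons] at h ⊢
    obtain ⟨rfl, -⟩ := phi_mem_U.1 h
    rw [col_phi_self]
    exact Br_mw v

theorem compl_U_preconnected (i : Fin (N + 3)) : IsPreconnected ((U i)ᶜ : Set (D N)) := by
  have hne : ∃ k : Fin (N + 3), k ≠ i := exists_ne i
  have : ((U i)ᶜ : Set (D N)) = ⋃ j : {j : Fin (N + 3) // j ≠ i}, Set.range (phi j.1) := by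
    ext x
    rw [Set.mem_iUnion]
    constructor
    · intro hx
      by_cases hm : x = m
      · obtain ⟨k, hk⟩ := hne
        exact ⟨⟨k, hk⟩, a, by rw [phi_a, hm]⟩
      · obtain ⟨j, y, hy, rfl⟩ := mem_U_of_ne hm
        refine ⟨⟨j, ?_⟩, y, rfl⟩
        rintro rfl
        exact hx (phi_mem_U.2 ⟨rfl, hy⟩)
    · rintro ⟨⟨j, hj⟩, y, rfl⟩ h
      exact hj (phi_mem_U.1 h).1
  rw [this]
  refine isPreconnected_iUnion ⟨m, Set.mem_iInter.2 fun j => m_mem_cell1 _⟩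
    fun j => cell1_preconnected _

/-- An element fixing `a` and moving `m` away from `a` moves all of `C`. -/
theorem move_C {g : K N} (ha : g a = a) {i : Fin (N + 3)} (hi : i ≠ 0) (hm : g m ∈ U i)
    {x : D N} (hx : x ∈ C N) : g x ∈ U i := by
  by_contra hn
  have hT := pre_img (compl_U_preconnected i) g⁻¹
  have ha' : (a : D N) ∈ (U i)ᶜ := fun h => hi (U_unique h a_mem_U)
  have hm' : m ∉ (g⁻¹ : K N) '' (U i)ᶜ := by
    rintro ⟨y, hy, e⟩
    rw [← e, ap_inv] at hm
    exact hy hm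
  exact hx (sub_U hT hm' ⟨a, ha', inv_eq ha⟩ a_mem_U ⟨g x, hn, inv_ap g x⟩)

theorem U_sub_C {i : Fin (N + 3)} (hi : i ≠ 0) {x : D N} (hx : x ∈ U i) : x ∈ C N :=
  fun h => hi (U_unique hx h)

theorem m_mem_C : (m : D N) ∈ C N := m_not_mem_U 0

theorem sepa (k : ℕ) : ∀ v : List (Fin (N + 3)), v.length ≤ k →
    ∃ g ∈ H N, ∃ i, i ≠ 0 ∧ g m ∈ U i ∧ g (mw (0 :: v)) ∈ C N ∧ g (mw (0 :: v)) ∉ U i := by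
  have hsm : s (m : D N) ∈ U 1 := by
    rw [s_m]
    exact phi_mem_U.2 ⟨rfl, m_ne_a⟩
  induction k with
  | zero =>
    intro v hv
    rw [List.length_eq_zero_iff.1 (Nat.le_zero.1 hv)]
    refine ⟨s, s_mem_H, 1, by simp, hsm, ?_⟩
    have : s (mw [0]) = (m : D N) := by
      rw [mw_cons, mw_nil]
      conv_lhs => rw [← phi_a 1, s_zero_one, phi_a]
    rw [this]
    exact ⟨m_mem_C, m_not_mem_U 1⟩
  | succ k ih =>
    intro v hv
    cases v with
    | nil => exact ih [] (Nat.zero_le _)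
    | cons j u =>
      rw [List.length_cons] at hv
      by_cases h0 : j = 0
      · subst h0
        obtain ⟨u', hu', e⟩ := flip_mw u
        obtain ⟨g, hg, i, hi, h1, h2, h3⟩ := ih u' (by omega)
        obtain ⟨l, hl, hloc⟩ := loc_mem_H hg (i := 1) (by simp)
        have e1 : ∀ {y : D N}, y ∈ C N → (s⁻¹ : K N) (phi 1 y) = y := fun hy => inv_eq (s_C hy)
        have em : (s⁻¹ * l * s : K N) m = g m := by
          rw [mul_ap, mul_ap, s_m, hloc.1, e1 (U_sub_C hi h1)]
        have ex : (s⁻¹ * l * s : K N) (mw (0 :: 0 :: u)) = g (mw (0 :: u')) := by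
          rw [mul_ap, mul_ap, mw_cons, mw_cons, s_zero_zero, e, hloc.1, ← mw_cons, e1 h2]
        refine ⟨s⁻¹ * l * s, mul_mem (mul_mem (inv_mem s_mem_H) hl) s_mem_H, i, hi, ?_⟩
        rw [em, ex]
        exact ⟨h1, h2, h3⟩
      · by_cases h1 : j = 1
        · subst h1
          obtain ⟨g, hg, i, hi, h1, h2, h3⟩ := ih u (by omega)
          refine ⟨g * s, mul_mem hg s_mem_H, i, hi, ?_⟩
          have ex : (g * s : K N) (mw (0 :: 1 :: u)) = g (mw (0 :: u)) := by
            rw [mul_ap, mw_cons, mw_cons, s_zero_one, mw_cons]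
          rw [ex, mul_ap]
          exact ⟨move_C (H_a hg) hi h1 (U_sub_C (by simp) hsm), h2, h3⟩
        · refine ⟨s, s_mem_H, 1, by simp, hsm, ?_⟩
          rw [mw_cons, mw_cons, s_zero_ne h0 h1]
          exact ⟨phi_mem_C h0 _, fun h => h1 (phi_mem_U.1 h).1⟩

theorem gather (F : Finset (D N)) (hF : F.Nonempty) (hb : ∀ x ∈ F, Br x) :
    ∃ g ∈ H N, (∀ x ∈ F, g x ∈ C N) ∧ ∀ i, i ≠ 0 → ∃ x ∈ F, g x ∉ U i := by
  induction hF using Finset.Nonempty.cons_induction with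
  | singleton x =>
    obtain ⟨w, rfl⟩ := hb x (by simp)
    obtain ⟨g, hg, h⟩ := trans_H w.length w le_rfl
    refine ⟨g, hg, ?_, fun i _ => ⟨mw w, by simp, by rw [h]; exact m_not_mem_U i⟩⟩
    intro y hy
    rw [Finset.mem_singleton.1 hy, h]
    exact m_mem_C
  | cons x F hx hF ih =>
    obtain ⟨g, hg, h1, h2⟩ := ih fun y hy => hb y (Finset.mem_cons_of_mem hy)
    by_cases hgx : g x ∈ C N
    · refine ⟨g, hg, fun y hy => ?_, fun i hi => ?_⟩
      · rcases Finset.mem_cons.1 hy with rfl | hy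
        · exact hgx
        · exact h1 y hy
      · obtain ⟨y, hy, h⟩ := h2 i hi
        exact ⟨y, Finset.mem_cons_of_mem hy, h⟩
    · have hgx' : g x ∈ U 0 := not_not.1 hgx
      obtain ⟨w, hw⟩ := Br_map g (hb x (Finset.mem_cons_self _ _))
      cases w with
      | nil => rw [hw] at hgx'; exact absurd hgx' (m_not_mem_U 0)
      | cons j v =>
        have hj : j = 0 := by
          rw [hw, mw_cons] at hgx'
          exact (phi_mem_U.1 hgx').1
        subst hj
        obtain ⟨g', hg', i, hi, k1, k2, k3⟩ := sepa v.length v le_rfl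
        have key : ∀ y ∈ F, (g' * g) y ∈ U i := fun y hy =>
          move_C (H_a hg') hi k1 (h1 y hy)
        have hxx : (g' * g) x = g' (mw (0 :: v)) := by rw [mul_ap, hw]
        refine ⟨g' * g, mul_mem hg' hg, fun y hy => ?_, fun i' hi' => ?_⟩
        · rcases Finset.mem_cons.1 hy with rfl | hy
          · rw [hxx]; exact k2
          · exact U_sub_C hi (key y hy)
        · by_cases e : i' = i
          · subst e
            exact ⟨x, Finset.mem_cons_self _ _, by rw [hxx]; exact k3⟩
          · obtain ⟨y, hy⟩ := hF
            exact ⟨y, Finset.mem_cons_of_mem hy, fun h => e (U_unique h (key y hy))⟩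

theorem U_map {f : K N} (hm : f m = m) {i j : Fin (N + 3)} {x y : D N} (hx : x ∈ U i)
    (hfx : f x ∈ U j) (hy : y ∈ U i) : f y ∈ U j := by
  refine sub_U (pre_img (U_preconnected i) f) ?_ ⟨x, hx, rfl⟩ hfx ⟨y, hy, rfl⟩
  rintro ⟨z, hz, e⟩
  rw [← hm] at e
  exact m_not_mem_U i (f.injective e ▸ hz)

theorem exists_perm {f : K N} (hm : f m = m) :
    ∃ r : Equiv.Perm (Fin (N + 3)), ∀ i x, x ∈ U i → sig r (f x) ∈ U i := by
  have hb : ∀ i, phi i b ∈ (U i : Set (D N)) := fun i => phi_mem_U.2 ⟨rfl, a_ne_b.symm⟩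
  have h1 : ∀ i, ∃ j, f (phi i b) ∈ U j := fun i => by
    refine mem_U_of_ne fun e => ?_
    rw [← hm] at e
    exact m_not_mem_U i (f.injective e ▸ hb i)
  choose p hp using h1
  have hinj : Function.Injective p := by
    intro i j e
    have h2 := U_map (f := f⁻¹) (inv_eq hm) (hp i) (by rw [inv_ap]; exact hb i) (e ▸ hp j)
    rw [inv_ap] at h2
    exact U_unique h2 (hb j)
  let e := Equiv.ofBijective p (Finite.injective_iff_bijective.1 hinj)
  refine ⟨e.symm, fun i x hx => ?_⟩
  obtain ⟨y, hy, h⟩ := U_map hm (hb i) (hp i) hx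
  rw [← h, sig_phi]
  refine phi_mem_U.2 ⟨?_, hy⟩
  exact (Equiv.symm_apply_eq e).2 rfl

theorem restr {f : K N} (hm : f m = m) (hU : ∀ i x, x ∈ U i → f x ∈ U i) (i : Fin (N + 3)) :
    ∃ h : K N, h a = a ∧ ∀ x, f (phi i x) = phi i (h x) := by
  have hU' : ∀ i x, x ∈ U i → f⁻¹ x ∈ U i := by
    intro i x hx
    obtain ⟨j, hj⟩ : ∃ j, f⁻¹ x ∈ U j := mem_U_of_ne fun e => by
      have : x = m := by rw [← ap_inv f x, e, hm]
      exact m_not_mem_U i (this ▸ hx)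
    have := hU j _ hj
    rw [ap_inv] at this
    rwa [U_unique hx this]
  have key : ∀ g : K N, g m = m → (∀ i x, x ∈ U i → g x ∈ U i) →
      ∀ x, phi i (col i (g (phi i x))) = g (phi i x) := by
    intro g gm gU x
    by_cases hx : x = a
    · subst hx
      have : col i (m : D N) = a := by rw [← phi_a i, col_phi_self]
      rw [phi_a, gm, this, phi_a]
    · obtain ⟨y, hy, e⟩ := gU i (phi i x) (phi_mem_U.2 ⟨rfl, hx⟩)
      rw [← e, col_phi_self]
  have k1 := key f hm hU
  have k2 := key f⁻¹ (inv_eq hm) hU'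
  refine ⟨mkK (fun x => col i (f (phi i x))) (fun x => col i (f⁻¹ (phi i x)))
    ((col_cont i).comp (f.continuous.comp (phi_cont i)))
    ((col_cont i).comp (f⁻¹.continuous.comp (phi_cont i))) ?_ ?_, ?_, ?_⟩
  · intro x
    rw [k1, inv_ap, col_phi_self]
  · intro x
    rw [k2, ap_inv, col_phi_self]
  · change col i (f (phi i a)) = a
    rw [phi_a, hm, ← phi_a i, col_phi_self]
  · intro x
    exact (k1 x).symm

theorem combine (Γ : Subgroup (K N)) (g : Fin (N + 3) → K N) (S : Finset (Fin (N + 3)))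
    (hS : ∀ i ∈ S, ∃ l ∈ Γ, IsLoc i (g i) l) :
    ∃ l ∈ Γ, (∀ i ∈ S, ∀ x, l (phi i x) = phi i (g i x)) ∧
      ∀ i, i ∉ S → ∀ x, l (phi i x) = phi i x := by
  induction S using Finset.induction_on with
  | empty => exact ⟨1, one_mem _, by simp, fun _ _ _ => rfl⟩
  | insert j S hj ih =>
    obtain ⟨l, hl, h1, h2⟩ := ih fun i hi => hS i (Finset.mem_insert_of_mem hi)
    obtain ⟨l', hl', h3, h4⟩ := hS j (Finset.mem_insert_self _ _)
    refine ⟨l' * l, mul_mem hl' hl, fun i hi x => ?_, fun i hi x => ?_⟩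
    · rcases Finset.mem_insert.1 hi with rfl | hi'
      · rw [mul_ap, h2 i hj, h3]
      · rw [mul_ap, h1 i hi', h4]
        rintro rfl
        exact hj hi'
    · rw [mul_ap, h2 i (fun h => hi (Finset.mem_insert_of_mem h)), h4]
      rintro rfl
      exact hi (Finset.mem_insert_self _ _)

open Classical in
theorem approx_H (k : ℕ) : ∀ F : Finset (D N), F.card ≤ k → (∀ x ∈ F, Br x) →
    ∀ h : K N, h a = a → ∃ g ∈ H N, ∀ x ∈ F, g x = h x := by
  induction k with
  | zero =>
    intro F hF _ h _
    rw [Finset.card_eq_zero.1 (Nat.le_zero.1 hF)]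
    exact ⟨1, one_mem _, by simp⟩
  | succ k ih =>
    intro F hF hb h ha
    rcases F.eq_empty_or_nonempty with rfl | hne
    · exact ⟨1, one_mem _, by simp⟩
    obtain ⟨g0, hg0, hC, hlt⟩ := gather F hne hb
    obtain ⟨v, hv⟩ := Br_map h (Br_map g0⁻¹ (Br_mw []))
    rw [mw_nil] at hv
    obtain ⟨g2, hg2, hm2⟩ := trans_H v.length v le_rfl
    have fm : (g2 * h * g0⁻¹) m = m := by rw [mul_ap, mul_ap, hv, hm2]
    have fa : (g2 * h * g0⁻¹) a = a := by
      rw [mul_ap, mul_ap, inv_eq (H_a hg0), ha, H_a hg2]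
    generalize hf : g2 * h * g0⁻¹ = f at fm fa
    obtain ⟨r, hr⟩ := exists_perm fm
    have r0 : r 0 = 0 := by
      have := hr 0 a a_mem_U
      rw [fa, ← phi_zero_b, sig_phi] at this
      exact (phi_mem_U.1 this).1
    have fm' : (sig r * f) m = m := by rw [mul_ap, fm, sig_m]
    choose h' ha' hh' using restr (f := sig r * f) fm' (fun i x hx => hr i x hx)
    have hex : ∀ i, ∃ g ∈ H N, i ≠ 0 →
        ∀ x ∈ (F.filter (fun x => g0 x ∈ U i)).image (fun x => col i (g0 x)), g x = h' i x := by
      intro i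
      by_cases hi : i = 0
      · exact ⟨1, one_mem _, fun h => absurd hi h⟩
      · obtain ⟨x, hx, hxU⟩ := hlt i hi
        have hcard : (F.filter (fun x => g0 x ∈ U i)).card < F.card := by
          refine Finset.card_lt_card (Finset.filter_ssubset.2 ⟨x, hx, hxU⟩)
        obtain ⟨g, hg, hgx⟩ := ih ((F.filter (fun x => g0 x ∈ U i)).image (fun x => col i (g0 x)))
          (le_trans Finset.card_image_le (by omega)) (by
            intro y hy
            obtain ⟨z, hz, rfl⟩ := Finset.mem_image.1 hy
            obtain ⟨hz, hzU⟩ := Finset.mem_filter.1 hz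
            exact Br_col (Br_map g0 (hb z hz)) hzU) (h' i) (ha' i)
        exact ⟨g, hg, fun _ => hgx⟩
    choose g hg hgx using hex
    obtain ⟨l, hl, hl1, -⟩ := combine (H N) g (Finset.univ.erase 0)
      (fun i hi => loc_mem_H (hg i) (Finset.ne_of_mem_erase hi))
    refine ⟨g2⁻¹ * (sig r)⁻¹ * l * g0, mul_mem (mul_mem (mul_mem (inv_mem hg2)
      (inv_mem (sig_mem_H r0))) hl) hg0, fun x hx => ?_⟩
    have hmain : l (g0 x) = (sig r * f) (g0 x) := by
      obtain ⟨i, y, hi, hy⟩ := mem_C_iff.1 (hC x hx)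
      rw [← hy, hl1 i (Finset.mem_erase.2 ⟨hi, Finset.mem_univ _⟩), hh']
      by_cases hya : y = a
      · rw [hya, H_a (hg i), ha']
      · rw [hgx i hi y]
        refine Finset.mem_image.2 ⟨x, Finset.mem_filter.2 ⟨hx, ?_⟩, ?_⟩
        · rw [← hy]
          exact phi_mem_U.2 ⟨rfl, hya⟩
        · rw [← hy, col_phi_self]
    rw [mul_ap, mul_ap, mul_ap, hmain, mul_ap, inv_ap, ← hf, mul_ap, mul_ap, inv_ap, inv_ap]

open Classical in
theorem approx_G (F : Finset (D N)) (hb : ∀ x ∈ F, Br x) (h : K N) :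
    ∃ g ∈ G N, ∀ x ∈ F, g x = h x := by
  obtain ⟨v, hv⟩ := Br_map h (Br_mw [])
  rw [mw_nil] at hv
  obtain ⟨g2, hg2, hm2⟩ := trans_G v
  have fm : (g2 * h) m = m := by rw [mul_ap, hv, hm2]
  generalize hf : g2 * h = f at fm
  obtain ⟨r, hr⟩ := exists_perm fm
  have fm' : (sig r * f) m = m := by rw [mul_ap, fm, sig_m]
  choose h' ha' hh' using restr (f := sig r * f) fm' (fun i x hx => hr i x hx)
  have hex : ∀ i, ∃ g ∈ H N,
      ∀ x ∈ (F.filter (fun x => x ∈ U i)).image (fun x => col i x), g x = h' i x := by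
    intro i
    refine approx_H _ _ le_rfl ?_ (h' i) (ha' i)
    intro y hy
    obtain ⟨z, hz, rfl⟩ := Finset.mem_image.1 hy
    obtain ⟨hz, hzU⟩ := Finset.mem_filter.1 hz
    exact Br_col (hb z hz) hzU
  choose g hg hgx using hex
  obtain ⟨l, hl, hl1, -⟩ := combine (G N) g Finset.univ (fun i _ => (hg i).2 i)
  refine ⟨g2⁻¹ * (sig r)⁻¹ * l, mul_mem (mul_mem (inv_mem hg2)
    (inv_mem (sig_mem r))) hl, fun x hx => ?_⟩
  have hmain : l x = (sig r * f) x := by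
    obtain ⟨i, y, hy⟩ := phi_surj x
    rw [← hy, hl1 i (Finset.mem_univ _), hh']
    by_cases hya : y = a
    · rw [hya, H_a (hg i), ha']
    · rw [hgx i y]
      refine Finset.mem_image.2 ⟨x, Finset.mem_filter.2 ⟨hx, ?_⟩, ?_⟩
      · rw [← hy]
        exact phi_mem_U.2 ⟨rfl, hya⟩
      · rw [← hy, col_phi_self]
  rw [mul_ap, mul_ap, hmain, mul_ap, inv_ap, ← hf, mul_ap, inv_ap]

/-! Density -/

def Pres (f : K N) (V : Finset (List (Fin (N + 3)))) : Prop :=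
  ∀ v ∈ V, ∀ i, ∀ y ∈ HS v i, f y ∈ HS v i

theorem Pres.mono {f : K N} {V V' : Finset (List (Fin (N + 3)))} (h : Pres f V') (hV : V ⊆ V') :
    Pres f V := fun v hv => h v (hV hv)

theorem open_pres {O : Set (D N)} (hO : IsOpen O) : ∀ x ∈ O,
    ∃ V, ∃ W ∈ 𝓝 x, ∀ f : K N, Pres f V → ∀ y ∈ W, f y ∈ O := by
  classical
  have hO' : TopologicalSpace.GenerateOpen
      (Set.range fun p : List (Fin (N + 3)) × Fin (N + 3) => (HS p.1 p.2 : Set (D N))) O := by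
    have := hO
    rw [top_eq] at this
    exact this
  clear hO
  induction hO' with
  | basic O h =>
    obtain ⟨⟨v, i⟩, rfl⟩ := h
    intro x hx
    exact ⟨{v}, HS v i, (HS_open v i).mem_nhds hx,
      fun f hf y hy => hf v (Finset.mem_singleton_self _) i y hy⟩
  | univ => exact fun x _ => ⟨∅, Set.univ, Filter.univ_mem, fun _ _ _ _ => trivial⟩
  | inter O O' _ _ ih ih' =>
    rintro x ⟨hx, hx'⟩
    obtain ⟨V, W, hW, h⟩ := ih x hx
    obtain ⟨V', W', hW', h'⟩ := ih' x hx'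
    exact ⟨V ∪ V', W ∩ W', Filter.inter_mem hW hW', fun f hf y hy =>
      ⟨h f (hf.mono Finset.subset_union_left) y hy.1,
        h' f (hf.mono Finset.subset_union_right) y hy.2⟩⟩
  | sUnion S _ ih =>
    rintro x ⟨O, hO, hx⟩
    obtain ⟨V, W, hW, h⟩ := ih O hO x hx
    exact ⟨V, W, hW, fun f hf y hy => ⟨O, hO, h f hf y hy⟩⟩

theorem compact_pres {O Q : Set (D N)} (hO : IsOpen O) (hQ : IsCompact Q) (hQO : Q ⊆ O) :
    ∃ V, ∀ f : K N, Pres f V → ∀ y ∈ Q, f y ∈ O := by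
  classical
  refine hQ.induction_on (p := fun Q => ∃ V, ∀ f : K N, Pres f V → ∀ y ∈ Q, f y ∈ O) ?_ ?_ ?_ ?_
  · exact ⟨∅, fun _ _ y hy => absurd hy (Set.notMem_empty y)⟩
  · rintro S T hST ⟨V, h⟩
    exact ⟨V, fun f hf y hy => h f hf y (hST hy)⟩
  · rintro S T ⟨V, h⟩ ⟨V', h'⟩
    refine ⟨V ∪ V', fun f hf y hy => ?_⟩
    rcases hy with hy | hy
    · exact h f (hf.mono Finset.subset_union_left) y hy
    · exact h' f (hf.mono Finset.subset_union_right) y hy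
  · intro x hx
    obtain ⟨V, W, hW, h⟩ := open_pres hO x (hQO hx)
    exact ⟨W, mem_nhdsWithin_of_mem_nhds hW, V, h⟩

theorem co_pres (h : K N) {O : Set C(D N, D N)} (hO : IsOpen O) (hh : (h : C(D N, D N)) ∈ O) :
    ∃ V, ∀ f : K N, Pres f V → ((h * f : K N) : C(D N, D N)) ∈ O := by
  classical
  have hO' : TopologicalSpace.GenerateOpen (Set.image2 (fun (K U : Set (D N)) =>
    {f : C(D N, D N) | Set.MapsTo f K U}) {K | IsCompact K} {U | IsOpen U}) O := hO
  clear hO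
  induction hO' with
  | basic O hO =>
    obtain ⟨Q, hQ, W, hW, rfl⟩ := hO
    obtain ⟨V, hV⟩ := compact_pres (O := h ⁻¹' W) (hW.preimage h.continuous) hQ hh
    exact ⟨V, fun f hf y hy => hV f hf y hy⟩
  | univ => exact ⟨∅, fun _ _ => trivial⟩
  | inter O O' _ _ ih ih' =>
    obtain ⟨V, h1⟩ := ih hh.1
    obtain ⟨V', h2⟩ := ih' hh.2
    exact ⟨V ∪ V', fun f hf => ⟨h1 f (hf.mono Finset.subset_union_left),
        h2 f (hf.mono Finset.subset_union_right)⟩⟩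
  | sUnion S _ ih =>
    obtain ⟨O, hO, hx⟩ := hh
    obtain ⟨V, h1⟩ := ih O hO hx
    exact ⟨V, fun f hf => ⟨O, hO, h1 f hf⟩⟩

theorem G_dense : Dense (G N : Set (K N)) := by
  classical
  rw [dense_iff_inter_open]
  rintro O hO ⟨h, hh⟩
  obtain ⟨O', hO', rfl⟩ := isOpen_induced_iff.1 hO
  obtain ⟨V, hV⟩ := co_pres h hO' hh
  obtain ⟨g, hg, e⟩ := approx_G (V.image mw ∪
    (V ×ˢ (Finset.univ : Finset (Fin (N + 3)))).image (fun p => mw (p.1 ++ [p.2]))) (by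
      intro x hx
      rcases Finset.mem_union.1 hx with hx | hx
      · obtain ⟨v, -, rfl⟩ := Finset.mem_image.1 hx
        exact Br_mw v
      · obtain ⟨p, -, rfl⟩ := Finset.mem_image.1 hx
        exact Br_mw _) h
  refine ⟨g, ?_, hg⟩
  have hp : Pres (h⁻¹ * g) V := by
    intro v hv i y hy
    have e1 : (h⁻¹ * g) (mw v) = mw v := by
      rw [mul_ap, e _ (Finset.mem_union_left _ (Finset.mem_image_of_mem _ hv)), inv_ap]
    have e2 : (h⁻¹ * g) (mw (v ++ [i])) = mw (v ++ [i]) := by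
      rw [mul_ap, e _ (Finset.mem_union_right _ (Finset.mem_image.2 ⟨(v, i),
        Finset.mem_product.2 ⟨hv, Finset.mem_univ _⟩, rfl⟩)), inv_ap]
    generalize h⁻¹ * g = f at e1 e2
    refine sub_HS (pre_img (HS_preconnected v i) f) ?_ ⟨_, mw_mem_HS v i, e2⟩
      (mw_mem_HS v i) ⟨y, hy, rfl⟩
    rintro ⟨z, hz, e⟩
    rw [← e1] at e
    exact mw_not_mem_HS v i (f.injective e ▸ hz)
  have := hV _ hp
  rwa [← mul_assoc, mul_inv_cancel, one_mul] at this

/-! Ping-pong -/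

@[reducible]
def actK : MulAction (K N) (D N) where
  smul f x := f x
  one_smul _ := rfl
  mul_smul _ _ _ := rfl

def gg : K N := sig (Equiv.swap 1 2) * s * sig (Equiv.swap 0 2)

theorem gg_mem : gg ∈ G N := mul_mem (mul_mem (sig_mem _) s_mem) (sig_mem _)

theorem gg_map {x : D N} (hx : x ∉ U 2) : gg x ∈ U 2 := by
  obtain ⟨i, y, rfl⟩ := phi_surj x
  have h : sig (Equiv.swap 0 2) (phi i y) ∈ C N := by
    rw [sig_phi]
    intro h
    obtain ⟨h1, h2⟩ := phi_mem_U.1 h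
    refine hx (phi_mem_U.2 ⟨?_, h2⟩)
    rw [← Equiv.eq_symm_apply] at h1
    rw [h1]
    simp
  rw [gg, mul_ap, mul_ap, s_C h, sig_phi, Equiv.swap_apply_left]
  refine phi_mem_U.2 ⟨rfl, fun e => ?_⟩
  rw [e] at h
  exact h a_mem_U

open Pointwise in
theorem free : ∃ L : Subgroup (G N), Nonempty (L ≃* FreeGroup (Fin 2)) := by
  letI : MulAction (K N) (D N) := actK
  have sm : ∀ (f : K N) (S : Set (D N)), f • S = f '' S := fun f S => rfl
  let P : Set (D N) := s '' (U 0)ᶜ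
  have hP : P ⊆ U 1 := by
    rintro _ ⟨x, hx, rfl⟩
    rw [s_C hx]
    refine phi_mem_U.2 ⟨rfl, ?_⟩
    rintro rfl
    exact hx a_mem_U
  have hPd : Disjoint P (U 0) := Set.disjoint_left.2 fun x h1 h2 => by
    have := U_unique (hP h1) h2
    simp at this
  have h12 : (1 : Fin (N + 3)) ≠ 2 := by
    intro h
    have := congrArg Fin.val h
    simp at this
    rw [Nat.mod_eq_of_lt (by omega)] at this
    omega
  have h02 : (0 : Fin (N + 3)) ≠ 2 := by
    intro h
    have := congrArg Fin.val h
    simp at this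
    rw [Nat.mod_eq_of_lt (by omega)] at this
    omega
  have g0 : gg '' U 0 ⊆ (U 2 : Set (D N)) := by
    rintro _ ⟨x, hx, rfl⟩
    exact gg_map fun h => h02 (U_unique hx h)
  have gP : gg '' P ⊆ (U 2 : Set (D N)) := by
    rintro _ ⟨x, hx, rfl⟩
    exact gg_map fun h => h12 (U_unique (hP hx) h)
  have dis : ∀ {i j : Fin (N + 3)} {A B : Set (D N)}, i ≠ j → A ⊆ U i → B ⊆ U j → Disjoint A B :=
    fun hij hA hB => Set.disjoint_left.2 fun x h1 h2 => hij (U_unique (hA h1) (hB h2))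
  have hgd : Disjoint (gg '' P) (gg '' U 0) := (Set.disjoint_image_iff gg.injective).2 hPd
  have nP : P.Nonempty := ⟨_, m, m_mem_C, rfl⟩
  have hinj := FreeGroup.injective_lift_of_ping_pong (![s, gg * s * gg⁻¹] : Fin 2 → K N)
    (![P, gg '' P]) (![U 0, gg '' U 0])
    (by
      intro i
      fin_cases i
      · exact nP
      · exact nP.image _)
    (by
      intro i j hij
      fin_cases i <;> fin_cases j
      · exact absurd rfl hij
      · exact dis h12 hP gP
      · exact (dis h12 hP gP).symm
      · exact absurd rfl hij)
    (by
      intro i j hij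
      fin_cases i <;> fin_cases j
      · exact absurd rfl hij
      · exact dis h02 subset_rfl g0
      · exact (dis h02 subset_rfl g0).symm
      · exact absurd rfl hij)
    (by
      intro i j
      fin_cases i <;> fin_cases j
      · exact hPd
      · exact dis h12 hP g0
      · exact (dis h02 subset_rfl gP).symm
      · exact hgd)
    (by
      intro i
      rw [sm]
      fin_cases i
      · exact subset_rfl
      · rintro _ ⟨x, hx, rfl⟩
        refine ⟨s (gg⁻¹ x), ⟨gg⁻¹ x, fun h => hx ⟨_, h, ap_inv _ _⟩, rfl⟩, rfl⟩)
    (by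
      intro i
      rw [sm]
      fin_cases i
      · rintro _ ⟨x, hx, rfl⟩
        change (s : K N)⁻¹ x ∈ U 0
        by_contra h
        exact hx ⟨_, h, ap_inv _ _⟩
      · rintro _ ⟨x, hx, rfl⟩
        change (gg * s * gg⁻¹ : K N)⁻¹ x ∈ gg '' U 0
        refine ⟨s⁻¹ (gg⁻¹ x), ?_, ?_⟩
        · by_contra h
          refine hx ⟨gg⁻¹ x, ⟨_, h, ap_inv _ _⟩, ap_inv _ _⟩
        · symm
          refine inv_eq ?_
          rw [mul_ap, mul_ap, inv_ap, ap_inv, ap_inv])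
  let ψ : FreeGroup (Fin 2) →* G N := FreeGroup.lift
    ![⟨s, s_mem⟩, ⟨gg * s * gg⁻¹, mul_mem (mul_mem gg_mem s_mem) (inv_mem gg_mem)⟩]
  have hψ : (G N).subtype.comp ψ = FreeGroup.lift (![s, gg * s * gg⁻¹] : Fin 2 → K N) := by
    ext i
    fin_cases i <;> simp [ψ]
  have hψi : Function.Injective ψ := by
    intro x y e
    apply hinj
    rw [← hψ, MonoidHom.comp_apply, MonoidHom.comp_apply, e]
  exact ⟨ψ.range, ⟨(MonoidHom.ofInjective hψi).symm⟩⟩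

end Wz

theorem statement17 (n : ℕ) (hn : 3 ≤ n) :
    ∃ (X : Type) (_ : TopologicalSpace X) (_ : IsWazewskiDendrite n X)
      (G : Subgroup (X ≃ₜ X)),
      G.FG ∧ Dense (G : Set (X ≃ₜ X)) ∧
      ∃ H : Subgroup G, Nonempty (H ≃* FreeGroup (Fin 2)) := by
  obtain ⟨N, rfl⟩ : ∃ N, n = N + 3 := ⟨n - 3, by omega⟩
  exact ⟨Wz.D N, Wz.instTopD N, Wz.isWazewski N, Wz.G N, Wz.G_fg, Wz.G_dense, Wz.free⟩
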